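/- Let x ∈ P have rank r ≥ 1 with {i : y_i ≤ x} = {1,…,r}. Then *E_x is the injective envelope of S_x = S/p_x in the category of Z^n-graded S-modules and degree-preserving S-homomorphisms; in particular, *E_x is an injective object of that category. -/

import Mathlib

open scoped Classical
open MvPolynomial

noncomputable section

variable (K : Type) [Field K]
variable (P : Type) [Fintype P] [PartialOrder P] [OrderBot P]

/-- A finite poset with a least element is *simplicial* if every lower interval
is isomorphic to a boolean algebra (the lattice of all subsets of a finite set). -/
def IsSimplicialPoset : Prop :=
  ∀ x : P, ∃ m : ℕ, Nonempty (Set.Iic x ≃o Finset (Fin m))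

/-- `P* := P \ {0̂}`. -/
abbrev Pstar := {z : P // z ≠ ⊥}

/-- The polynomial ring `S = K[t_z : z ∈ P*]`. -/
abbrev FaceS := MvPolynomial (Pstar P) K

/-- The variable `t_z`, with the convention `t_{0̂} = 1`. -/
def tvar (z : P) : FaceS K P := if h : z = ⊥ then 1 else X ⟨z, h⟩

/-- The set `[a ∨ b]` of minimal elements of the common upper bounds of `a` and `b`. -/
def minUB (a b : P) : Set P :=
  {z | a ≤ z ∧ b ≤ z ∧ ∀ w, a ≤ w → b ≤ w → ¬ w < z}

/-- Minimal elements of the common upper bounds of a set `A`. -/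
def minUBset (A : Set P) : Set P :=
  {z | (∀ a ∈ A, a ≤ z) ∧ ∀ w, (∀ a ∈ A, a ≤ w) → ¬ w < z}

/-- The meet `a ∧ b`, i.e. the largest common lower bound, when it exists (`⊥` otherwise). -/
def pmeet (a b : P) : P :=
  if h : ∃ m, m ≤ a ∧ m ≤ b ∧ ∀ w, w ≤ a → w ≤ b → w ≤ m then h.choose else ⊥

/-- The generator `f_{a,b} = t_a t_b - t_{a ∧ b} ∑_{z ∈ [a ∨ b]} t_z` of the face ideal. -/
def fgen (a b : Pstar P) : FaceS K P :=
  X a * X b - tvar K P (pmeet P a.1 b.1) *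
    ∑ z ∈ (Set.toFinite (minUB P a.1 b.1)).toFinset, tvar K P z

/-- The face ideal `I_P`. -/
def faceIdeal : Ideal (FaceS K P) :=
  Ideal.span (Set.range fun p : Pstar P × Pstar P => fgen K P p.1 p.2)

variable (n : ℕ) (y : Fin n → P)

/-- `y` is an enumeration of the rank one elements (= atoms) of `P`. -/
def AtomEnum : Prop :=
  Function.Injective y ∧ ∀ p : P, IsAtom p ↔ ∃ i, y i = p

/-- The rank of an element: the number of atoms below it. -/
def prank (z : P) : ℕ := (Finset.univ.filter fun i : Fin n => y i ≤ z).card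

/-- The `ℤⁿ`-degree of the variable `t_z`: `deg t_z = ∑_{y_i ≤ z} e_i`. -/
def tdeg (z : Pstar P) : Fin n → ℤ := fun i => if y i ≤ z.1 then 1 else 0

/-- `w = ∑_{z ∈ P*} deg t_z`. -/
def wvec : Fin n → ℤ := fun i => ∑ z : Pstar P, tdeg P n y z i

/-- The degree `d` homogeneous component of `S` for the `ℤⁿ`-grading. -/
def Sgrade (d : Fin n → ℤ) : AddSubgroup (FaceS K P) :=
  (weightedHomogeneousSubmodule K (tdeg P n y) d).toAddSubgroup

/-- The transformed variable `t̃_z` (relative to `x`), with `t̃_{0̂} = 1`. -/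
def ttil (x z : P) : FaceS K P :=
  if z ≤ x ∧ 2 ≤ prank P n y z then
    tvar K P z - ∏ i ∈ Finset.univ.filter fun i : Fin n => y i ≤ z, tvar K P (y i)
  else tvar K P z

/-- The graded prime ideal `p_x = (t_z : z ≰ x) + I_P`. -/
def pIdeal (x : P) : Ideal (FaceS K P) :=
  Ideal.span ((fun z : Pstar P => (X z : FaceS K P)) '' {z | ¬ z.1 ≤ x}) ⊔ faceIdeal K P

/-- The indices of the atoms below `x`. -/
abbrev BelowIx (x : P) := {i : Fin n // y i ≤ x}

/-- `P*_{-x}`: the elements of `P*` which are not atoms below `x`. -/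
abbrev Pmx (x : P) := {z : P // z ≠ ⊥ ∧ ¬ ∃ i : Fin n, y i ≤ x ∧ y i = z}

/-- Index monoid for the "big Laurent" model of `*E_x`. -/
abbrev EIdx (x : P) := (BelowIx P n y x →₀ ℤ) × (Pmx P n y x →₀ ℤ)

/-- The "big Laurent" algebra `K[t_i^{±1} : y_i ≤ x] ⊗_K K[t̃_z^{±1} : z ∈ P*_{-x}]`. -/
abbrev Gx (x : P) := AddMonoidAlgebra K (EIdx P n y x)

/-- Exponent vector of `π_x(t_z) = ∏_{y_i ≤ z} t_i`. -/
def dvec (x : P) (z : P) : BelowIx P n y x →₀ ℤ :=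
  Finsupp.equivFunOnFinite.symm fun i => if y i.1 ≤ z then 1 else 0

/-- The action of `S` on the big Laurent algebra through the comultiplication
`Δ(t_z) = t_z ⊗ 1 + 1 ⊗ t_z`:  the variable `t_z` acts as `π_x(t_z) ⊗ 1 + 1 ⊗ t_z`. -/
def theta (x : P) : FaceS K P →ₐ[K] Gx K P n y x :=
  aeval fun z : Pstar P =>
    (if z.1 ≤ x then AddMonoidAlgebra.single (dvec P n y x z.1, 0) 1 else 0) +
    (if h : ∃ i : Fin n, y i ≤ x ∧ y i = z.1 then 0
     else AddMonoidAlgebra.single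
       ((0 : BelowIx P n y x →₀ ℤ), Finsupp.single (⟨z.1, z.2, h⟩ : Pmx P n y x) (1 : ℤ)) 1)

instance gxModule (x : P) : Module (FaceS K P) (Gx K P n y x) :=
  Module.compHom _ (theta K P n y x).toRingHom

instance gxTower (x : P) : IsScalarTower K (FaceS K P) (Gx K P n y x) := by
  refine ⟨fun k s g => ?_⟩
  show theta K P n y x (k • s) * g = k • (theta K P n y x s * g)
  rw [map_smul, smul_mul_assoc]

instance gxComm (x : P) : SMulCommClass (FaceS K P) K (Gx K P n y x) := by
  refine ⟨fun s k g => ?_⟩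
  show theta K P n y x s * (k • g) = k • (theta K P n y x s * g)
  exact mul_smul_comm k _ g

/-- The submodule by which we quotient the big Laurent algebra to obtain `*E_x`. -/
def Ux (x : P) : Submodule (FaceS K P) (Gx K P n y x) :=
  Submodule.span (FaceS K P)
    {g | ∃ p : EIdx P n y x, (∃ w, 0 < p.2 w) ∧ g = AddMonoidAlgebra.single p 1}

/-- The `ℤⁿ`-graded `S`-module `*E_x = K[t_i^{±1} : y_i ≤ x] ⊗_K K[t_z^{-1} : z ∈ P*_{-x}]`. -/
abbrev ExMod (x : P) := Gx K P n y x ⧸ Ux K P n y x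

instance exComm (x : P) : SMulCommClass (FaceS K P) K (ExMod K P n y x) := by
  refine ⟨fun s k e => ?_⟩
  obtain ⟨g, rfl⟩ := Submodule.Quotient.mk_surjective _ e
  simp only [← Submodule.Quotient.mk_smul]
  rw [smul_comm]

def mIdx (x : P) (a : BelowIx P n y x →₀ ℤ) (b : Pmx P n y x →₀ ℕ) : EIdx P n y x :=
  (a, -Finsupp.mapRange (Nat.cast : ℕ → ℤ) Nat.cast_zero b)

/-- The monomial `∏ t_i^{a_i} ⊗ ∏ t_z^{-b_z}` of `*E_x`. -/
def emono (x : P) (a : BelowIx P n y x →₀ ℤ) (b : Pmx P n y x →₀ ℕ) : ExMod K P n y x :=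
  Submodule.Quotient.mk (AddMonoidAlgebra.single (mIdx P n y x a b) 1)

/-- `1_x = 1 ⊗ 1 ∈ *E_x`. -/
def onex (x : P) : ExMod K P n y x := emono K P n y x 0 0

/-- The `ℤⁿ`-degree of the monomial of `*E_x` with index `p`. -/
def gdeg (x : P) (p : EIdx P n y x) : Fin n → ℤ := fun i =>
  (if h : y i ≤ x then p.1 ⟨i, h⟩ else 0) +
    p.2.sum fun w c => c * (if y i ≤ w.1 then 1 else 0)

/-- The degree `aa` homogeneous component of `*E_x`. -/
def ExGrade (x : P) (aa : Fin n → ℤ) : Submodule K (ExMod K P n y x) :=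
  Submodule.span K
    {e | ∃ p : EIdx P n y x, gdeg P n y x p = aa ∧
      e = Submodule.Quotient.mk (AddMonoidAlgebra.single p 1)}

/-- `L(*E_x)`: the span of the basis monomials with nontrivial second factor and
componentwise nonnegative `ℤⁿ`-degree. -/
def cleanL (x : P) : Submodule K (ExMod K P n y x) :=
  Submodule.span K
    {e | ∃ a b, b ≠ 0 ∧ (∀ i, 0 ≤ gdeg P n y x (mIdx P n y x a b) i) ∧
      e = emono K P n y x a b}

/-- Degree preserving homomorphisms `*E_x → *E_z` (elements of `[*Hom(E_x, E_z)]_0`). -/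
def DegZero (x z : P) (φ : ExMod K P n y x →ₗ[FaceS K P] ExMod K P n y z) : Prop :=
  ∀ aa, ∀ e ∈ ExGrade K P n y x aa, φ e ∈ ExGrade K P n y z aa

/-- Clean homomorphisms `*E_x → *E_z`. -/
def IsClean (x z : P) (φ : ExMod K P n y x →ₗ[FaceS K P] ExMod K P n y z) : Prop :=
  DegZero K P n y x z φ ∧ ∀ e ∈ cleanL K P n y x, φ e ∈ cleanL K P n y z


/-- A `ℤⁿ`-grading on an `S`-module `M`, compatible with the `ℤⁿ`-grading of `S`:
an object of the category `*Mod S`. -/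
structure GradedSMod (M : Type) [AddCommGroup M] [Module (FaceS K P) M] where
  grade : (Fin n → ℤ) → AddSubgroup M
  internal : DirectSum.IsInternal grade
  smul_le : ∀ (d aa : Fin n → ℤ) (s : FaceS K P), s ∈ Sgrade K P n y d →
    ∀ m ∈ grade aa, s • m ∈ grade (aa + d)

section MacaulayInverseSystem

variable {σ F : Type} [Field F]

/-- The exponents `b` such that `T ^ (-b)` is moved by `T ^ c` to the exponent `b - c`: the shift
operator of Macaulay's inverse system, `(T ^ c • d) b = d (b + c)`. -/
def inverseShift : Multiplicative (σ →₀ ℕ) →* Module.End F ((σ →₀ ℕ) →₀ F) where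
  toFun c := Finsupp.lcomapDomain (fun b => b + c.toAdd) (add_left_injective _)
  map_one' := by
    ext1 b
    ext c
    simp
  map_mul' c d := by
    refine LinearMap.ext fun v => Finsupp.ext fun b => ?_
    simp only [toAdd_mul, Finsupp.lcomapDomain_apply, Finsupp.comapDomain_apply,
      Module.End.mul_apply]
    congr 1
    abel

/-- Macaulay's inverse system `F[T⁻¹]` as a module over the polynomial ring `F[T]`; the finitely
supported function `d` stands for `∑ d(b) T ^ (-b)`. -/
instance inverseSystemModule : Module (MvPolynomial σ F) ((σ →₀ ℕ) →₀ F) :=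
  Module.compHom _ (AddMonoidAlgebra.lift F (Module.End F ((σ →₀ ℕ) →₀ F)) (σ →₀ ℕ)
    inverseShift).toRingHom

lemma inverseSystem_smul_apply (s : MvPolynomial σ F) (d : (σ →₀ ℕ) →₀ F) (b : σ →₀ ℕ) :
    (s • d) b = ∑ c ∈ s.support, s.coeff c * d (b + c) := by
  change (AddMonoidAlgebra.lift F (Module.End F ((σ →₀ ℕ) →₀ F)) (σ →₀ ℕ) inverseShift s) d b = _
  rw [AddMonoidAlgebra.lift_apply', Finsupp.sum, LinearMap.sum_apply, Finsupp.finsetSum_apply]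
  refine Finset.sum_congr rfl fun c _ => ?_
  rw [Module.End.mul_apply, Module.algebraMap_end_apply]
  rfl

lemma inverseSystem_monomial_smul_apply (c : σ →₀ ℕ) (k : F) (d : (σ →₀ ℕ) →₀ F) (b : σ →₀ ℕ) :
    (monomial c k • d) b = k * d (b + c) := by
  rw [inverseSystem_smul_apply]
  by_cases hk : k = 0
  · simp [hk]
  · simp [support_monomial, hk]

instance inverseSystem_isScalarTower :
    IsScalarTower F (MvPolynomial σ F) ((σ →₀ ℕ) →₀ F) := by
  refine ⟨fun k s d => ?_⟩
  change (AddMonoidAlgebra.lift F (Module.End F ((σ →₀ ℕ) →₀ F)) (σ →₀ ℕ) inverseShift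
    (k • s)) d = k • (AddMonoidAlgebra.lift F (Module.End F ((σ →₀ ℕ) →₀ F)) (σ →₀ ℕ)
      inverseShift s) d
  rw [map_smul, LinearMap.smul_apply]

lemma exists_pow_idealOfVars_smul_eq_zero (d : (σ →₀ ℕ) →₀ F) :
    ∃ k : ℕ, ∀ j ≥ k, ∀ s ∈ idealOfVars σ F ^ j, s • d = 0 := by
  refine ⟨d.support.sup Finsupp.degree + 1, fun j hj s hs => Finsupp.ext fun b => ?_⟩
  rw [inverseSystem_smul_apply]
  refine Finset.sum_eq_zero fun c hc => ?_
  have hdeg := (mem_pow_idealOfVars_iff j s).1 hs c hc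
  have : d (b + c) = 0 := by
    by_contra h
    have h1 := Finset.le_sup (f := Finsupp.degree) (Finsupp.mem_support_iff.2 h)
    rw [map_add] at h1
    omega
  rw [this, mul_zero]

/-- A linear functional vanishing on the kernel of a linear map factors through that map. -/
lemma exists_comp_eq_of_ker_le {V W : Type} [AddCommGroup V] [AddCommGroup W] [Module F V]
    [Module F W] (q : V →ₗ[F] W) (l : V →ₗ[F] F) (h : LinearMap.ker q ≤ LinearMap.ker l) :
    ∃ μ : W →ₗ[F] F, ∀ v, μ (q v) = l v := by
  have hl : l ∈ LinearMap.range q.dualMap := by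
    rw [LinearMap.range_dualMap_eq_dualAnnihilator_ker, Submodule.mem_dualAnnihilator]
    exact fun w hw => h hw
  obtain ⟨μ, rfl⟩ := hl
  exact ⟨μ, fun v => rfl⟩

lemma exists_pow_idealOfVars_map_eq_zero [Finite σ] (I : Ideal (MvPolynomial σ F))
    (f : I →ₗ[MvPolynomial σ F] ((σ →₀ ℕ) →₀ F)) :
    ∃ k : ℕ, ∀ s : I, (s : MvPolynomial σ F) ∈ idealOfVars σ F ^ k → f s = 0 := by
  obtain ⟨G, hG⟩ := (inferInstance : Module.Finite (MvPolynomial σ F) I).fg_top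
  have hk : ∃ k : ℕ, ∀ s ∈ idealOfVars σ F ^ k, ∀ u : I, s • f u = 0 := by
    choose κ hκ using fun u : I => exists_pow_idealOfVars_smul_eq_zero (f u)
    refine ⟨G.sup κ, fun s hs u => ?_⟩
    have hu : u ∈ Submodule.span (MvPolynomial σ F) (G : Set I) := hG ▸ Submodule.mem_top
    induction hu using Submodule.span_induction with
    | mem u hu => exact hκ u _ (Finset.le_sup hu) s hs
    | zero => simp
    | add u v _ _ h1 h2 => rw [map_add, smul_add, h1, h2, add_zero]
    | smul a u _ h => rw [map_smul, smul_comm, h, smul_zero]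
  obtain ⟨k, hk⟩ := hk
  obtain ⟨k₀, h₀⟩ := Ideal.exists_pow_inf_eq_pow_smul (idealOfVars σ F) (M := MvPolynomial σ F) I
  refine ⟨k + k₀, fun s hs => ?_⟩
  have hmem : (s : MvPolynomial σ F) ∈
      idealOfVars σ F ^ k • (idealOfVars σ F ^ k₀ • (⊤ : Submodule _ (MvPolynomial σ F)) ⊓ I) := by
    have := h₀ (k + k₀) (Nat.le_add_left _ _)
    rw [Nat.add_sub_cancel] at this
    rw [← this]
    exact ⟨by simpa using hs, s.2⟩
  have key : ∀ p ∈ idealOfVars σ F ^ k •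
      (idealOfVars σ F ^ k₀ • (⊤ : Submodule _ (MvPolynomial σ F)) ⊓ I),
      ∃ hp : p ∈ I, f ⟨p, hp⟩ = 0 := by
    intro p hp
    induction hp using Submodule.smul_induction_on' with
    | smul r hr m hm => exact ⟨I.mul_mem_left r hm.2, by
        rw [← hk r hr ⟨m, hm.2⟩, ← map_smul]; rfl⟩
    | add u _ v _ h1 h2 =>
      obtain ⟨hu, h1⟩ := h1
      obtain ⟨hv, h2⟩ := h2
      exact ⟨I.add_mem hu hv, by
        rw [← add_zero (0 : (σ →₀ ℕ) →₀ F)]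
        nth_rewrite 1 [← h1]
        rw [← h2, ← map_add]; rfl⟩
  exact (key s hmem).2

/-- Macaulay's inverse system is an injective module over the polynomial ring. -/
theorem inverseSystem_injective [Finite σ] :
    Module.Injective (MvPolynomial σ F) ((σ →₀ ℕ) →₀ F) := by
  refine Module.Baer.injective fun I f => ?_
  obtain ⟨N, hN⟩ := exists_pow_idealOfVars_map_eq_zero I f
  have : Finite {c : σ →₀ ℕ | Finsupp.degree c < N} := by
    have := Fintype.ofFinite σ
    exact (Finsupp.finite_of_degree_le N).subset fun c (hc : Finsupp.degree c < N) => hc.le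
  let Q := (idealOfVars σ F ^ N).restrictScalars F
  obtain ⟨μ, hμ⟩ := exists_comp_eq_of_ker_le
    (Q.mkQ ∘ₗ (I.restrictScalars F).subtype)
    (Finsupp.lapply 0 ∘ₗ (f.restrictScalars F : I.restrictScalars F →ₗ[F] _)) (by
      intro s hs
      rw [LinearMap.mem_ker, LinearMap.comp_apply, Submodule.mkQ_apply,
        Submodule.Quotient.mk_eq_zero] at hs
      have := hN s hs
      change f s 0 = 0
      rw [this, Finsupp.zero_apply])
  have hfin : (Function.support fun b : σ →₀ ℕ => μ (Q.mkQ (monomial b 1))).Finite := by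
    refine Set.Finite.subset (s := {c : σ →₀ ℕ | Finsupp.degree c < N}) (Set.toFinite _)
      fun b hb => ?_
    by_contra h
    refine hb ?_
    have : (monomial b 1 : MvPolynomial σ F) ∈ Q := by
      change _ ∈ idealOfVars σ F ^ N
      rw [mem_pow_idealOfVars_iff']
      intro c hc
      rw [coeff_monomial, if_neg]
      rintro rfl
      exact h hc
    simp only [Submodule.mkQ_apply, (Submodule.Quotient.mk_eq_zero Q).2 this, map_zero]
  let d₀ : (σ →₀ ℕ) →₀ F := Finsupp.ofSupportFinite _ hfin
  have hd₀ : ∀ (s : MvPolynomial σ F) b, (s • d₀) b = μ (Q.mkQ (monomial b 1 * s)) := by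
    intro s b
    induction s using MvPolynomial.induction_on' with
    | monomial c k =>
      rw [inverseSystem_monomial_smul_apply, monomial_mul, one_mul]
      change k * μ (Q.mkQ (monomial (b + c) 1)) = _
      rw [← smul_eq_mul, ← map_smul, ← map_smul, smul_monomial, smul_eq_mul, mul_one]
    | add p q hp hq => rw [add_smul, Finsupp.add_apply, hp, hq, mul_add, map_add, map_add]
  refine ⟨LinearMap.toSpanSingleton _ _ d₀, fun s hs => Finsupp.ext fun b => ?_⟩
  rw [LinearMap.toSpanSingleton_apply, hd₀]
  have h1 := hμ ⟨monomial b 1 * s, I.mul_mem_left _ hs⟩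
  refine h1.trans ?_
  have h2 : f ⟨monomial b 1 * s, I.mul_mem_left _ hs⟩ =
      (monomial b 1 : MvPolynomial σ F) • f ⟨s, hs⟩ := by
    rw [← map_smul]; rfl
  change f ⟨monomial b 1 * s, I.mul_mem_left _ hs⟩ 0 = _
  rw [h2, inverseSystem_monomial_smul_apply, one_mul, zero_add]

end MacaulayInverseSystem

/-- Extension of semilinear maps into an injective module, modulo a given submodule `J`. -/
lemma exists_extension_vanishing {A S M D : Type} [CommRing A] [CommRing S] (φ : A →+* S)
    [AddCommGroup M] [Module S M] [AddCommGroup D] [Module A D] [Module.Injective A D]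
    (N J : Submodule S M) (f : N →+ D) (hf : ∀ a n, f (φ a • n) = a • f n)
    (hJ : ∀ n : N, (n : M) ∈ J → f n = 0) :
    ∃ g : M →+ D, (∀ a m, g (φ a • m) = a • g m) ∧ (∀ m ∈ J, g m = 0) ∧ ∀ n : N, g n = f n := by
  let _ : Module A N := Module.compHom N φ
  let _ : Module A (M ⧸ J) := Module.compHom (M ⧸ J) φ
  let ψ : N →ₗ[A] M ⧸ J :=
    { toFun := fun n => J.mkQ n
      map_add' := fun a b => by simp
      map_smul' := fun a n => by
        change J.mkQ (φ a • (n : M)) = φ a • J.mkQ n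
        rw [map_smul] }
  let f' : N →ₗ[A] D := { f with map_smul' := hf }
  have hker : LinearMap.ker ψ ≤ LinearMap.ker f' := fun n hn =>
    hJ n ((Submodule.Quotient.mk_eq_zero J).1 hn)
  obtain ⟨h, hh⟩ := Module.Injective.out ((LinearMap.ker ψ).liftQ ψ le_rfl)
    (LinearMap.ker_eq_bot.1 (Submodule.ker_liftQ_eq_bot _ _ _ le_rfl))
    ((LinearMap.ker ψ).liftQ f' hker)
  refine ⟨h.toAddMonoidHom.comp J.mkQ.toAddMonoidHom, fun a m => ?_, fun m hm => ?_, fun n => ?_⟩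
  · change h (J.mkQ (φ a • m)) = a • h (J.mkQ m)
    rw [← map_smul h]
    rfl
  · change h (J.mkQ m) = 0
    rw [Submodule.mkQ_apply, (Submodule.Quotient.mk_eq_zero J).2 hm, map_zero]
  · exact hh (Submodule.Quotient.mk n)


set_option linter.unusedSectionVars false

section Coefficients

/-- Index set of the monomial basis of `*E_x`. -/
abbrev ECoefIdx (x : P) := (BelowIx P n y x →₀ ℤ) × (Pmx P n y x →₀ ℕ)

variable {K P n y}

lemma mIdx_injective (x : P) :
    Function.Injective fun q : ECoefIdx P n y x => mIdx P n y x q.1 q.2 := by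
  rintro ⟨a, b⟩ ⟨a', b'⟩ h
  simp only [mIdx, Prod.mk.injEq, neg_inj] at h
  exact Prod.ext h.1 (Finsupp.mapRange_injective _ Nat.cast_zero Nat.cast_injective h.2)

lemma neg_left_add_mIdx {x : P} (c a : BelowIx P n y x →₀ ℤ) (b : Pmx P n y x →₀ ℕ) :
    -((c, 0) : EIdx P n y x) + mIdx P n y x a b = mIdx P n y x (a - c) b := by
  simp only [mIdx, Prod.neg_mk, Prod.mk_add_mk, neg_zero, zero_add]
  rw [neg_add_eq_sub]

lemma neg_right_add_mIdx {x : P} (a : BelowIx P n y x →₀ ℤ) (b d : Pmx P n y x →₀ ℕ) :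
    -((0, Finsupp.mapRange (Nat.cast : ℕ → ℤ) Nat.cast_zero d) : EIdx P n y x) +
      mIdx P n y x a b = mIdx P n y x a (b + d) := by
  simp only [mIdx, Prod.neg_mk, Prod.mk_add_mk, neg_zero, zero_add]
  rw [Finsupp.mapRange_add (by simp), neg_add, add_comm]

lemma exists_pos_or_eq_mIdx {x : P} (p : EIdx P n y x) :
    (∃ w, 0 < p.2 w) ∨ ∃ a b, p = mIdx P n y x a b := by
  refine or_iff_not_imp_left.2 fun h => ?_
  push Not at h
  refine ⟨p.1, Finsupp.mapRange Int.natAbs rfl p.2, Prod.ext rfl (Finsupp.ext fun w => ?_)⟩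
  have := h w
  simp only [mIdx, Finsupp.neg_apply, Finsupp.mapRange_apply]
  omega

lemma mIdx_not_pos {x : P} (a : BelowIx P n y x →₀ ℤ) (b : Pmx P n y x →₀ ℕ) :
    ¬ ∃ w, 0 < (mIdx P n y x a b).2 w := by
  rintro ⟨w, hw⟩
  simp only [mIdx, Finsupp.neg_apply, Finsupp.mapRange_apply] at hw
  omega

lemma face_smul_def {x : P} (s : FaceS K P) (g : Gx K P n y x) :
    s • g = theta K P n y x s * g := rfl

/-- The Laurent polynomials without terms in the monomial basis of `*E_x`. -/
def vanishing (x : P) : Submodule (FaceS K P) (Gx K P n y x) where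
  carrier := {g | ∀ a b, g.coeff (mIdx P n y x a b) = 0}
  zero_mem' := fun a b => rfl
  add_mem' := fun {f g} hf hg a b => by
    rw [AddMonoidAlgebra.coeff_add, Finsupp.add_apply, hf, hg, add_zero]
  smul_mem' := fun s => by
    induction s using MvPolynomial.induction_on with
    | C k =>
      intro g hg a b
      rw [face_smul_def, ← algebraMap_eq, AlgHom.commutes, ← Algebra.smul_def,
        AddMonoidAlgebra.coeff_smul_apply, hg, smul_zero]
    | add p q hp hq =>
      intro g hg a b
      rw [add_smul, AddMonoidAlgebra.coeff_add, Finsupp.add_apply, hp hg, hq hg, add_zero]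
    | mul_X p z hp =>
      intro g hg
      rw [mul_smul]
      refine hp fun a b => ?_
      rw [face_smul_def, theta, aeval_X, add_mul, AddMonoidAlgebra.coeff_add, Finsupp.add_apply]
      have h1 : ((if z.1 ≤ x then AddMonoidAlgebra.single (dvec P n y x z.1, 0) 1 else 0 :
          Gx K P n y x) * g).coeff (mIdx P n y x a b) = 0 := by
        split_ifs
        · rw [AddMonoidAlgebra.coeff_single_mul_apply, neg_left_add_mIdx, hg, mul_zero]
        · rw [zero_mul]; rfl
      rw [h1, zero_add]
      split_ifs with h
      · rw [zero_mul]; rfl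
      · have := neg_right_add_mIdx a b (Finsupp.single ⟨z.1, z.2, h⟩ 1)
        rw [Finsupp.mapRange_single, Nat.cast_one] at this
        rw [AddMonoidAlgebra.coeff_single_mul_apply, this, hg, mul_zero]

lemma Ux_eq_vanishing (x : P) : Ux K P n y x = vanishing x := by
  apply le_antisymm
  · refine Submodule.span_le.2 ?_
    rintro _ ⟨p, hp, rfl⟩ a b
    rw [AddMonoidAlgebra.coeff_single, Finsupp.single_apply, if_neg]
    rintro rfl
    exact mIdx_not_pos a b hp
  · intro g hg
    rw [← AddMonoidAlgebra.sum_coeff_single g]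
    refine Submodule.sum_mem _ fun p hp => ?_
    rcases exists_pos_or_eq_mIdx p with h | ⟨a, b, rfl⟩
    · have : AddMonoidAlgebra.single p (g.coeff p) =
          (C (g.coeff p) : FaceS K P) • (AddMonoidAlgebra.single p 1 : Gx K P n y x) := by
        rw [face_smul_def, ← algebraMap_eq, AlgHom.commutes, ← Algebra.smul_def,
          AddMonoidAlgebra.smul_single, smul_eq_mul, mul_one]
      rw [this]
      exact Submodule.smul_mem _ _ (Submodule.subset_span ⟨p, h, rfl⟩)
    · exact absurd (hg a b) (Finsupp.mem_support_iff.1 hp)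

/-- The coefficients of an element of `*E_x` in the basis of monomials. -/
def ecoef (x : P) : ExMod K P n y x →ₗ[K] (ECoefIdx P n y x →₀ K) :=
  Submodule.liftQ ((Ux K P n y x).restrictScalars K)
    ((Finsupp.lcomapDomain _ (mIdx_injective x)).comp
      (AddMonoidAlgebra.coeffLinearEquiv K).toLinearMap) (by
      intro g hg
      rw [Submodule.restrictScalars_mem, Ux_eq_vanishing] at hg
      exact Finsupp.ext fun q => hg q.1 q.2) ∘ₗ
  (Submodule.Quotient.restrictScalarsEquiv K (Ux K P n y x)).symm.toLinearMap

lemma ecoef_mk {x : P} (g : Gx K P n y x) (q : ECoefIdx P n y x) :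
    ecoef x (Submodule.Quotient.mk g : ExMod K P n y x) q = g.coeff (mIdx P n y x q.1 q.2) := rfl

lemma ecoef_injective (x : P) : Function.Injective (ecoef (K := K) (n := n) (y := y) x) := by
  rw [← LinearMap.ker_eq_bot, eq_bot_iff]
  intro e he
  obtain ⟨g, rfl⟩ := Submodule.Quotient.mk_surjective _ e
  refine (Submodule.Quotient.mk_eq_zero _).2 ?_
  rw [Ux_eq_vanishing]
  intro a b
  rw [← ecoef_mk g (a, b), LinearMap.mem_ker.1 he, Finsupp.zero_apply]

lemma ecoef_emono {x : P} (a : BelowIx P n y x →₀ ℤ) (b : Pmx P n y x →₀ ℕ) :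
    ecoef x (emono K P n y x a b) = Finsupp.single (a, b) 1 := by
  ext q
  rw [emono, ecoef_mk, AddMonoidAlgebra.coeff_single, Finsupp.single_apply, Finsupp.single_apply]
  exact if_congr ⟨fun h => mIdx_injective x h, fun h => by rw [← h]⟩ rfl rfl

lemma mk_single_eq_zero {x : P} {p : EIdx P n y x} (hp : ∃ w, 0 < p.2 w) :
    (Submodule.Quotient.mk (AddMonoidAlgebra.single p 1) : ExMod K P n y x) = 0 :=
  (Submodule.Quotient.mk_eq_zero _).2 (Submodule.subset_span ⟨p, hp, rfl⟩)

lemma eq_sum_emono {x : P} (e : ExMod K P n y x) :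
    e = ∑ q ∈ (ecoef x e).support, ecoef x e q • emono K P n y x q.1 q.2 := by
  apply ecoef_injective
  rw [map_sum]
  simp only [map_smul, ecoef_emono, Finsupp.smul_single, smul_eq_mul, mul_one]
  exact (Finsupp.sum_single _).symm

lemma smul_mk_apply {x : P} {s : FaceS K P} {p : EIdx P n y x}
    (hs : theta K P n y x s = AddMonoidAlgebra.single p 1) (g : Gx K P n y x)
    (q : EIdx P n y x) : (s • g).coeff q = g.coeff (-p + q) := by
  rw [face_smul_def, hs, AddMonoidAlgebra.coeff_single_mul_apply, one_mul]

lemma ecoef_smul_left {x : P} {s : FaceS K P} {c : BelowIx P n y x →₀ ℤ}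
    (hs : theta K P n y x s = AddMonoidAlgebra.single (c, 0) 1) (e : ExMod K P n y x)
    (a : BelowIx P n y x →₀ ℤ) (b : Pmx P n y x →₀ ℕ) :
    ecoef x (s • e) (a, b) = ecoef x e (a - c, b) := by
  obtain ⟨g, rfl⟩ := Submodule.Quotient.mk_surjective _ e
  rw [← Submodule.Quotient.mk_smul, ecoef_mk, ecoef_mk, smul_mk_apply hs, neg_left_add_mIdx]

lemma ecoef_smul_right {x : P} {s : FaceS K P} {d : Pmx P n y x →₀ ℕ}
    (hs : theta K P n y x s =
      AddMonoidAlgebra.single (0, Finsupp.mapRange (Nat.cast : ℕ → ℤ) Nat.cast_zero d) 1)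
    (e : ExMod K P n y x) (a : BelowIx P n y x →₀ ℤ) (b : Pmx P n y x →₀ ℕ) :
    ecoef x (s • e) (a, b) = ecoef x e (a, b + d) := by
  obtain ⟨g, rfl⟩ := Submodule.Quotient.mk_surjective _ e
  rw [← Submodule.Quotient.mk_smul, ecoef_mk, ecoef_mk, smul_mk_apply hs, neg_right_add_mIdx]

end Coefficients

section Monomials

variable {P n y}

lemma prod_single_one {ι G : Type} [AddCommMonoid G] (s : Finset ι) (f : ι → G) :
    ∏ i ∈ s, (AddMonoidAlgebra.single (f i) 1 : AddMonoidAlgebra K G) =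
      AddMonoidAlgebra.single (∑ i ∈ s, f i) 1 := by
  induction s using Finset.induction_on with
  | empty => rfl
  | insert i s hi h =>
    rw [Finset.prod_insert hi, Finset.sum_insert hi, h, AddMonoidAlgebra.single_mul_single, one_mul]

lemma atom_le_atom_iff (hy : AtomEnum P n y) (i j : Fin n) : y j ≤ y i ↔ j = i := by
  refine ⟨fun h => hy.1 ?_, fun h => h ▸ le_rfl⟩
  have hi := (hy.2 (y i)).2 ⟨i, rfl⟩
  have hj := (hy.2 (y j)).2 ⟨j, rfl⟩
  exact (hi.le_iff.1 h).resolve_left hj.1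

lemma atom_ne_bot (hy : AtomEnum P n y) (i : Fin n) : y i ≠ ⊥ := ((hy.2 (y i)).2 ⟨i, rfl⟩).1

lemma dvec_eq_sum (x z : P) :
    dvec P n y x z = ∑ i, if y i.1 ≤ z then Finsupp.single i 1 else 0 := by
  ext j
  rw [Finsupp.finsetSum_apply, Finset.sum_eq_single j]
  · simp only [dvec, Finsupp.equivFunOnFinite_symm_apply_apply]
    split_ifs <;> simp
  · intro i _ hij
    split_ifs
    · rw [Finsupp.single_eq_of_ne hij.symm]
    · rfl
  · simp

lemma dvec_atom (hy : AtomEnum P n y) {x : P} (i : BelowIx P n y x) :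
    dvec P n y x (y i) = Finsupp.single i 1 := by
  rw [dvec_eq_sum, Finset.sum_eq_single i]
  · simp
  · intro j _ hj
    rw [if_neg]
    exact fun h => hj (Subtype.ext ((atom_le_atom_iff hy _ _).1 h))
  · simp

lemma theta_tvar_atom (hy : AtomEnum P n y) {x : P} (i : BelowIx P n y x) :
    theta K P n y x (tvar K P (y i)) = AddMonoidAlgebra.single (Finsupp.single i 1, 0) 1 := by
  rw [tvar, dif_neg (atom_ne_bot hy i), theta, aeval_X, if_pos i.2,
    dif_pos ⟨i.1, i.2, rfl⟩, add_zero, dvec_atom hy]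

/-- The product of the variables of the atoms below both `x` and `z`. -/
def atomProd (x z : P) : FaceS K P := ∏ i : BelowIx P n y x, if y i ≤ z then tvar K P (y i) else 1

lemma theta_atomProd (hy : AtomEnum P n y) (x z : P) :
    theta K P n y x (atomProd (n := n) (y := y) K x z) =
      AddMonoidAlgebra.single (dvec P n y x z, 0) 1 := by
  have h : ∀ i : BelowIx P n y x,
      theta K P n y x (if y i ≤ z then tvar K P (y i) else 1) =
        AddMonoidAlgebra.single (if y i.1 ≤ z then Finsupp.single i 1 else 0, 0) 1 := by
    intro i
    split_ifs
    · exact theta_tvar_atom K hy i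
    · exact map_one _
  rw [atomProd, map_prod, Finset.prod_congr rfl fun i _ => h i, prod_single_one, dvec_eq_sum]
  congr 1
  refine Prod.ext ?_ ?_
  · rw [Prod.fst_sum]
  · rw [Prod.snd_sum, Finset.sum_const_zero]

/-- A variable of `S` modified so that it acts on `*E_x` through the second tensor factor. -/
def shiftVar (x : P) (w : Pmx P n y x) : FaceS K P :=
  X ⟨w.1, w.2.1⟩ - if w.1 ≤ x then atomProd (n := n) (y := y) K x w.1 else 0

lemma theta_shiftVar (hy : AtomEnum P n y) {x : P} (w : Pmx P n y x) :
    theta K P n y x (shiftVar K x w) = AddMonoidAlgebra.single (0, Finsupp.single w 1) 1 := by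
  have h : theta K P n y x (if w.1 ≤ x then atomProd (n := n) (y := y) K x w.1 else 0) =
      if w.1 ≤ x then AddMonoidAlgebra.single (dvec P n y x w.1, 0) 1 else 0 := by
    split_ifs
    · exact theta_atomProd K hy x w.1
    · exact map_zero _
  rw [shiftVar, map_sub, h, theta, aeval_X, dif_neg w.2.2, add_sub_cancel_left]

/-- The subalgebra of `S` generated by the atoms below `x`. -/
def atomHom (x : P) : MvPolynomial (BelowIx P n y x) K →ₐ[K] FaceS K P :=
  aeval fun i => tvar K P (y i)

/-- The subalgebra of `S` acting on the second tensor factor of `*E_x`. -/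
def shiftHom (x : P) : MvPolynomial (Pmx P n y x) K →ₐ[K] FaceS K P := aeval (shiftVar K x)

lemma algHom_monomial_eq_single {σ G : Type} [AddCommMonoid G]
    (f : MvPolynomial σ K →ₐ[K] AddMonoidAlgebra K G) (v : (σ →₀ ℤ) →+ G)
    (hf : ∀ i, f (X i) = AddMonoidAlgebra.single (v (Finsupp.single i 1)) 1) (c : σ →₀ ℕ) :
    f (monomial c 1) =
      AddMonoidAlgebra.single (v (Finsupp.mapRange (Nat.cast : ℕ → ℤ) Nat.cast_zero c)) 1 := by
  induction c using Finsupp.induction_linear with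
  | zero => rw [← C_apply, C_1, map_one, Finsupp.mapRange_zero, map_zero]; rfl
  | add c d hc hd =>
    rw [Finsupp.mapRange_add (by simp), map_add, ← one_mul (1 : K),
      ← AddMonoidAlgebra.single_mul_single, ← hc, ← hd, ← map_mul, monomial_mul]
  | single i k =>
    rw [← X_pow_eq_monomial, map_pow, hf, AddMonoidAlgebra.single_pow, one_pow, ← map_nsmul,
      Finsupp.mapRange_single]
    simp

lemma theta_atomHom_monomial (hy : AtomEnum P n y) {x : P} (c : BelowIx P n y x →₀ ℕ) :
    theta K P n y x (atomHom K x (monomial c 1)) =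
      AddMonoidAlgebra.single (Finsupp.mapRange (Nat.cast : ℕ → ℤ) Nat.cast_zero c, 0) 1 :=
  algHom_monomial_eq_single K ((theta K P n y x).comp (atomHom K x)) (AddMonoidHom.inl _ _)
    (fun i => by
      rw [AlgHom.comp_apply, atomHom, aeval_X, theta_tvar_atom K hy]; rfl) c

lemma theta_shiftHom_monomial (hy : AtomEnum P n y) {x : P} (d : Pmx P n y x →₀ ℕ) :
    theta K P n y x (shiftHom K x (monomial d 1)) =
      AddMonoidAlgebra.single (0, Finsupp.mapRange (Nat.cast : ℕ → ℤ) Nat.cast_zero d) 1 :=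
  algHom_monomial_eq_single K ((theta K P n y x).comp (shiftHom K x)) (AddMonoidHom.inr _ _)
    (fun i => by
      rw [AlgHom.comp_apply, shiftHom, aeval_X, theta_shiftVar K hy]; rfl) d

end Monomials


section Essential

variable {P n y}

lemma emono_nat_eq_smul_onex (hy : AtomEnum P n y) {x : P} (c : BelowIx P n y x →₀ ℕ) :
    emono K P n y x (Finsupp.mapRange (Nat.cast : ℕ → ℤ) Nat.cast_zero c) 0 =
      atomHom K x (monomial c 1) • onex K P n y x := by
  apply ecoef_injective
  ext ⟨a, b⟩
  rw [ecoef_smul_left (theta_atomHom_monomial K hy c), onex, ecoef_emono, ecoef_emono,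
    Finsupp.single_apply, Finsupp.single_apply]
  refine if_congr ?_ rfl rfl
  rw [Prod.mk.injEq, Prod.mk.injEq, eq_comm (a := (0 : BelowIx P n y x →₀ ℤ)), sub_eq_zero,
    eq_comm (a := a)]

lemma exists_smul_mem_span_onex (hy : AtomEnum P n y) {x : P} {α : ExMod K P n y x} (hα : α ≠ 0) :
    ∃ s : FaceS K P, s • α ≠ 0 ∧ s • α ∈ Submodule.span (FaceS K P) {onex K P n y x} := by
  have hne : (ecoef x α).support.Nonempty := by
    rw [Finsupp.support_nonempty_iff]
    exact fun h => hα (ecoef_injective x (h.trans (map_zero _).symm))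
  obtain ⟨⟨a₀, b₀⟩, h₀, hmax⟩ :=
    Finset.exists_max_image _ (fun q : ECoefIdx P n y x => Finsupp.degree q.2) hne
  let c : BelowIx P n y x →₀ ℕ :=
    ∑ q ∈ (ecoef x α).support, Finsupp.mapRange Int.natAbs Int.natAbs_zero q.1
  have hc : ∀ q ∈ (ecoef x α).support, ∀ i, (q.1 i).natAbs ≤ c i := by
    intro q hq i
    have := Finset.single_le_sum (f := fun q : ECoefIdx P n y x =>
      Finsupp.mapRange Int.natAbs Int.natAbs_zero q.1) (fun _ _ => zero_le) hq i
    simpa [c] using this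
  let c' : BelowIx P n y x →₀ ℤ := Finsupp.mapRange (Nat.cast : ℕ → ℤ) Nat.cast_zero c
  have hcoef : ∀ a b, ecoef x ((atomHom K x (monomial c 1) * shiftHom K x (monomial b₀ 1)) • α)
      (a, b) = ecoef x α (a - c', b + b₀) := by
    intro a b
    rw [mul_smul, ecoef_smul_left (theta_atomHom_monomial K hy c),
      ecoef_smul_right (theta_shiftHom_monomial K hy b₀)]
  refine ⟨atomHom K x (monomial c 1) * shiftHom K x (monomial b₀ 1), fun h => ?_, ?_⟩
  · have := hcoef (a₀ + c') 0
    rw [h, map_zero, add_sub_cancel_right, zero_add, Finsupp.zero_apply] at this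
    exact Finsupp.mem_support_iff.1 h₀ this.symm
  · rw [eq_sum_emono ((atomHom K x (monomial c 1) * shiftHom K x (monomial b₀ 1)) • α)]
    refine Submodule.sum_mem _ fun ⟨a, b⟩ hq => Submodule.smul_of_tower_mem _ _ ?_
    rw [Finsupp.mem_support_iff, hcoef, ← Finsupp.mem_support_iff] at hq
    have hb : b = 0 := by
      have := hmax _ hq
      simp only [map_add] at this
      rw [← Finsupp.degree_eq_zero_iff]
      omega
    have ha : a = Finsupp.mapRange (Nat.cast : ℕ → ℤ) Nat.cast_zero
        (Finsupp.mapRange Int.natAbs Int.natAbs_zero a) := by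
      ext i
      have := hc _ hq i
      simp only [Finsupp.sub_apply, c', Finsupp.mapRange_apply] at this ⊢
      omega
    simp only [hb]
    rw [ha, emono_nat_eq_smul_onex K hy]
    exact Submodule.smul_mem _ _ (Submodule.mem_span_singleton_self _)

end Essential

section FaceIdeal

variable {P n y}

/-- The set of atoms below both `x` and `z`. -/
def atomsBelow (y : Fin n → P) (x z : P) : Finset (BelowIx P n y x) :=
  Finset.univ.filter fun i => y i ≤ z

lemma mem_atomsBelow {x z : P} {i : BelowIx P n y x} : i ∈ atomsBelow y x z ↔ y i ≤ z := by
  simp [atomsBelow]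

lemma le_iff_atomsBelow_subset (hP : IsSimplicialPoset P) (hy : AtomEnum P n y) {x z w : P}
    (hz : z ≤ x) (hw : w ≤ x) : z ≤ w ↔ atomsBelow y x z ⊆ atomsBelow y x w := by
  refine ⟨fun h i hi => mem_atomsBelow.2 ((mem_atomsBelow.1 hi).trans h), fun h => ?_⟩
  obtain ⟨m, ⟨e⟩⟩ := hP x
  suffices e ⟨z, hz⟩ ≤ e ⟨w, hw⟩ from e.le_iff_le.1 this
  intro j hj
  have hatom : IsAtom (e.symm {j}) := (OrderIso.isAtom_iff e.symm _).2 (Finset.isAtom_singleton j)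
  obtain ⟨i, hi⟩ := (hy.2 _).1 hatom.of_isAtom_coe_Iic
  have hz' : (e.symm {j} : P) ≤ z := by
    have : e.symm {j} ≤ ⟨z, hz⟩ := by
      rw [OrderIso.symm_apply_le]
      exact Finset.singleton_subset_iff.2 hj
    exact this
  have hi' : (⟨i, hi.symm ▸ (e.symm {j}).2⟩ : BelowIx P n y x) ∈ atomsBelow y x w :=
    h (mem_atomsBelow.2 (hi.symm ▸ hz'))
  rw [mem_atomsBelow, hi] at hi'
  have : e.symm {j} ≤ ⟨w, hw⟩ := hi'
  rw [OrderIso.symm_apply_le] at this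
  exact Finset.singleton_subset_iff.1 this

lemma eq_of_atomsBelow_eq (hP : IsSimplicialPoset P) (hy : AtomEnum P n y) {x z w : P}
    (hz : z ≤ x) (hw : w ≤ x) (h : atomsBelow y x z = atomsBelow y x w) : z = w :=
  le_antisymm ((le_iff_atomsBelow_subset hP hy hz hw).2 h.subset)
    ((le_iff_atomsBelow_subset hP hy hw hz).2 h.symm.subset)

lemma exists_atomsBelow_eq (hP : IsSimplicialPoset P) (hy : AtomEnum P n y) (x : P)
    (T : Finset (BelowIx P n y x)) : ∃ z ≤ x, atomsBelow y x z = T := by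
  obtain ⟨m, ⟨e⟩⟩ := hP x
  let u : BelowIx P n y x → Set.Iic x := fun i => ⟨y i, i.2⟩
  refine ⟨e.symm (T.biUnion fun i => e (u i)), (e.symm _).2, Finset.ext fun k => ?_⟩
  have hk : y k ≤ (e.symm (T.biUnion fun i => e (u i)) : P) ↔
      e (u k) ⊆ T.biUnion fun i => e (u i) := by
    change u k ≤ e.symm _ ↔ _
    rw [OrderIso.le_symm_apply]
  rw [mem_atomsBelow, hk]
  refine ⟨fun h => ?_, fun h => Finset.subset_biUnion_of_mem (fun i => e (u i)) h⟩
  have hatom : IsAtom (e (u k)) :=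
    (OrderIso.isAtom_iff e _).2 (((hy.2 _).2 ⟨k.1, rfl⟩).Iic k.2)
  obtain ⟨j, hj⟩ := Finset.isAtom_iff.1 hatom
  rw [hj, Finset.singleton_subset_iff, Finset.mem_biUnion] at h
  obtain ⟨i, hi, hji⟩ := h
  have : e (u k) ≤ e (u i) := by
    rw [hj]
    exact Finset.singleton_subset_iff.2 hji
  have : y k ≤ y i := e.le_iff_le.1 this
  rw [atom_le_atom_iff hy] at this
  rwa [Subtype.ext this]

lemma atomsBelow_bot (hy : AtomEnum P n y) (x : P) : atomsBelow y x ⊥ = ∅ :=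
  Finset.eq_empty_of_forall_notMem fun i hi =>
    atom_ne_bot hy i (le_bot_iff.1 (mem_atomsBelow.1 hi))

lemma pmeet_le_and_atomsBelow (hP : IsSimplicialPoset P) (hy : AtomEnum P n y) {x a b : P}
    (ha : a ≤ x) (hb : b ≤ x) :
    pmeet P a b ≤ x ∧ atomsBelow y x (pmeet P a b) = atomsBelow y x a ∩ atomsBelow y x b := by
  have hex : ∃ m, m ≤ a ∧ m ≤ b ∧ ∀ w, w ≤ a → w ≤ b → w ≤ m := by
    obtain ⟨m, hm, hT⟩ := exists_atomsBelow_eq hP hy x (atomsBelow y x a ∩ atomsBelow y x b)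
    refine ⟨m, ?_, ?_, fun w hwa hwb => ?_⟩
    · rw [le_iff_atomsBelow_subset hP hy hm ha, hT]
      exact Finset.inter_subset_left
    · rw [le_iff_atomsBelow_subset hP hy hm hb, hT]
      exact Finset.inter_subset_right
    · rw [le_iff_atomsBelow_subset hP hy (hwa.trans ha) hm, hT]
      exact Finset.subset_inter ((le_iff_atomsBelow_subset hP hy (hwa.trans ha) ha).1 hwa)
        ((le_iff_atomsBelow_subset hP hy (hwa.trans ha) hb).1 hwb)
  obtain ⟨h1, h2, h3⟩ := hex.choose_spec
  rw [pmeet, dif_pos hex]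
  refine ⟨h1.trans ha, Finset.ext fun i => ?_⟩
  rw [Finset.mem_inter, mem_atomsBelow, mem_atomsBelow, mem_atomsBelow]
  exact ⟨fun h => ⟨h.trans h1, h.trans h2⟩, fun h => h3 _ h.1 h.2⟩

lemma mem_minUB_iff_eq (hP : IsSimplicialPoset P) (hy : AtomEnum P n y) {x a b j z : P}
    (ha : a ≤ x) (hb : b ≤ x) (hj : j ≤ x)
    (hT : atomsBelow y x j = atomsBelow y x a ∪ atomsBelow y x b) (hz : z ≤ x) :
    z ∈ minUB P a b ↔ z = j := by
  have hle : ∀ w ≤ x, a ≤ w → b ≤ w → j ≤ w := fun w hw haw hbw => by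
    rw [le_iff_atomsBelow_subset hP hy hj hw, hT]
    exact Finset.union_subset ((le_iff_atomsBelow_subset hP hy ha hw).1 haw)
      ((le_iff_atomsBelow_subset hP hy hb hw).1 hbw)
  have haj : a ≤ j := by
    rw [le_iff_atomsBelow_subset hP hy ha hj, hT]
    exact Finset.subset_union_left
  have hbj : b ≤ j := by
    rw [le_iff_atomsBelow_subset hP hy hb hj, hT]
    exact Finset.subset_union_right
  constructor
  · rintro ⟨haz, hbz, hmin⟩
    exact ((hle z hz haz hbz).eq_of_not_lt (hmin j haj hbj)).symm
  · rintro rfl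
    exact ⟨haj, hbj, fun w haw hbw hwj => hwj.not_ge (hle w (hwj.le.trans hj) haw hbw)⟩

lemma sum_minUB_sub_mem (hP : IsSimplicialPoset P) (hy : AtomEnum P n y) {x a b j : P}
    (ha : a ≤ x) (hb : b ≤ x) (hj : j ≤ x)
    (hT : atomsBelow y x j = atomsBelow y x a ∪ atomsBelow y x b) {J : Ideal (FaceS K P)}
    (hJ : ∀ z : P, ¬ z ≤ x → tvar K P z ∈ J) :
    ∑ z ∈ (Set.toFinite (minUB P a b)).toFinset, tvar K P z - tvar K P j ∈ J := by
  have hmem : j ∈ (Set.toFinite (minUB P a b)).toFinset := by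
    rw [Set.Finite.mem_toFinset, mem_minUB_iff_eq hP hy ha hb hj hT hj]
  rw [← Finset.add_sum_erase _ _ hmem, add_sub_cancel_left]
  refine Ideal.sum_mem _ fun z hz => hJ z fun hzx => ?_
  rw [Finset.mem_erase, Set.Finite.mem_toFinset] at hz
  exact hz.1 ((mem_minUB_iff_eq hP hy ha hb hj hT hzx).1 hz.2)

lemma tvar_mem_pIdeal {x z : P} (hz : ¬ z ≤ x) : tvar K P z ∈ pIdeal K P x := by
  have h : z ≠ ⊥ := fun h => hz (h ▸ bot_le)
  rw [tvar, dif_neg h]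
  exact Ideal.mem_sup_left (Ideal.subset_span ⟨⟨z, h⟩, hz, rfl⟩)

lemma tvar_coe (z : Pstar P) : tvar K P z.1 = X z := by rw [tvar, dif_neg z.2]

lemma tvar_sub_prod_mem_pIdeal (hP : IsSimplicialPoset P) (hy : AtomEnum P n y) (x : P)
    (T : Finset (BelowIx P n y x)) :
    ∀ z ≤ x, atomsBelow y x z = T → tvar K P z - ∏ i ∈ T, tvar K P (y i) ∈ pIdeal K P x := by
  induction T using Finset.induction_on with
  | empty =>
    intro z hz hT
    have : z = ⊥ := eq_of_atomsBelow_eq hP hy hz bot_le (hT.trans (atomsBelow_bot hy x).symm)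
    rw [this, tvar, dif_pos rfl, Finset.prod_empty, sub_self]
    exact zero_mem _
  | insert i T hi ih =>
    intro z hz hT
    obtain ⟨z', hz', hT'⟩ := exists_atomsBelow_eq hP hy x T
    have hyi : atomsBelow y x (y i) = {i} := Finset.ext fun k => by
      rw [mem_atomsBelow, atom_le_atom_iff hy, Finset.mem_singleton, Subtype.ext_iff]
    have hprod : tvar K P (y i) * tvar K P z' - tvar K P z ∈ pIdeal K P x := by
      by_cases h : z' = ⊥
      · subst h
        rw [atomsBelow_bot hy] at hT'
        have : z = y i := eq_of_atomsBelow_eq hP hy hz i.2 (by rw [hT, hyi, ← hT']; rfl)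
        rw [this, show tvar K P (⊥ : P) = 1 from dif_pos rfl, mul_one, sub_self]
        exact zero_mem _
      · obtain ⟨hm, hmT⟩ := pmeet_le_and_atomsBelow hP hy i.2 hz'
        have hbot : pmeet P (y i) z' = ⊥ := by
          refine eq_of_atomsBelow_eq hP hy hm bot_le ?_
          rw [hmT, hyi, hT', atomsBelow_bot hy, Finset.singleton_inter_of_notMem hi]
        have hgen : fgen K P ⟨y i, atom_ne_bot hy i⟩ ⟨z', h⟩ ∈ pIdeal K P x :=
          Ideal.mem_sup_right (Ideal.subset_span ⟨(_, _), rfl⟩)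
        have hsum := sum_minUB_sub_mem K hP hy (j := z) i.2 hz' hz
          (by rw [hT, hyi, hT']; rfl) (J := pIdeal K P x) fun z hz => tvar_mem_pIdeal K hz
        rw [fgen, hbot, show tvar K P (⊥ : P) = 1 from dif_pos rfl, one_mul, ← tvar_coe,
          ← tvar_coe] at hgen
        have := Ideal.add_mem _ hgen hsum
        rwa [sub_add_sub_cancel] at this
    have := Ideal.sub_mem _ (Ideal.mul_mem_left _ (tvar K P (y i)) (ih z' hz' hT')) hprod
    rw [Finset.prod_insert hi]
    convert this using 1
    ring

lemma atomProd_eq_prod (x z : P) :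
    atomProd (n := n) (y := y) K x z = ∏ i ∈ atomsBelow y x z, tvar K P (y i) := by
  rw [atomProd, atomsBelow, Finset.prod_filter]

/-- The projection of `S` onto the polynomial ring `S_x = S / p_x`. -/
def stalkHom (y : Fin n → P) (x : P) : FaceS K P →ₐ[K] MvPolynomial (BelowIx P n y x) K :=
  aeval fun z => if z.1 ≤ x then ∏ i ∈ atomsBelow y x z.1, X i else 0

lemma stalkHom_tvar (hy : AtomEnum P n y) {x z : P} (hz : z ≤ x) :
    stalkHom K y x (tvar K P z) = ∏ i ∈ atomsBelow y x z, X i := by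
  by_cases h : z = ⊥
  · rw [tvar, dif_pos h, map_one, h, atomsBelow_bot hy, Finset.prod_empty]
  · rw [tvar, dif_neg h, stalkHom, aeval_X, if_pos hz]

lemma stalkHom_tvar_of_not_le {x z : P} (hz : ¬ z ≤ x) : stalkHom K y x (tvar K P z) = 0 := by
  have h : z ≠ ⊥ := fun h => hz (h ▸ bot_le)
  rw [tvar, dif_neg h, stalkHom, aeval_X, if_neg hz]

lemma stalkHom_fgen (hP : IsSimplicialPoset P) (hy : AtomEnum P n y) (x : P) (a b : Pstar P) :
    stalkHom K y x (fgen K P a b) = 0 := by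
  rw [fgen, map_sub, map_mul, map_mul, ← tvar_coe, ← tvar_coe, sub_eq_zero]
  by_cases hab : a.1 ≤ x ∧ b.1 ≤ x
  · obtain ⟨ha, hb⟩ := hab
    obtain ⟨j, hj, hT⟩ := exists_atomsBelow_eq hP hy x (atomsBelow y x a.1 ∪ atomsBelow y x b.1)
    have hsum := sum_minUB_sub_mem K hP hy ha hb hj hT
      (J := RingHom.ker (stalkHom K y x)) fun z hz => stalkHom_tvar_of_not_le K hz
    obtain ⟨hm, hmT⟩ := pmeet_le_and_atomsBelow hP hy ha hb
    rw [RingHom.mem_ker, map_sub, sub_eq_zero] at hsum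
    rw [hsum, stalkHom_tvar K hy ha, stalkHom_tvar K hy hb, stalkHom_tvar K hy hj,
      stalkHom_tvar K hy hm, hmT, hT, mul_comm (∏ i ∈ _ ∩ _, _), Finset.prod_union_inter]
  · have h0 : stalkHom K y x (tvar K P a.1) * stalkHom K y x (tvar K P b.1) = 0 := by
      rw [not_and_or] at hab
      rcases hab with h | h
      · rw [stalkHom_tvar_of_not_le K h, zero_mul]
      · rw [stalkHom_tvar_of_not_le K h, mul_zero]
    rw [h0, map_sum, Finset.sum_eq_zero, mul_zero]
    intro z hz
    rw [Set.Finite.mem_toFinset] at hz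
    exact stalkHom_tvar_of_not_le K fun h => hab ⟨hz.1.trans h, hz.2.1.trans h⟩

lemma stalkHom_eq_zero_of_mem_pIdeal (hP : IsSimplicialPoset P) (hy : AtomEnum P n y) {x : P}
    {s : FaceS K P} (hs : s ∈ pIdeal K P x) : stalkHom K y x s = 0 := by
  suffices pIdeal K P x ≤ RingHom.ker (stalkHom K y x) from this hs
  refine sup_le (Ideal.span_le.2 ?_) (Ideal.span_le.2 ?_)
  · rintro _ ⟨z, hz, rfl⟩
    have := stalkHom_tvar_of_not_le K (y := y) hz
    rwa [tvar_coe] at this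
  · rintro _ ⟨⟨a, b⟩, rfl⟩
    exact stalkHom_fgen K hP hy x a b

lemma sub_atomHom_stalkHom_mem {x : P} {J : Ideal (FaceS K P)}
    (h₀ : ∀ z : Pstar P, ¬ z.1 ≤ x → X z ∈ J)
    (h₁ : ∀ z : Pstar P, z.1 ≤ x → X z - atomProd (n := n) (y := y) K x z.1 ∈ J)
    (s : FaceS K P) : s - atomHom K x (stalkHom K y x s) ∈ J := by
  rw [← Ideal.Quotient.mk_eq_mk_iff_sub_mem]
  have : (Ideal.Quotient.mkₐ K J) =
      ((Ideal.Quotient.mkₐ K J).comp (atomHom K x)).comp (stalkHom K y x) := by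
    refine algHom_ext fun z => ?_
    rw [AlgHom.comp_apply, AlgHom.comp_apply, Ideal.Quotient.mkₐ_eq_mk,
      Ideal.Quotient.mk_eq_mk_iff_sub_mem, stalkHom, aeval_X]
    split_ifs with h
    · rw [map_prod]
      simp only [atomHom, aeval_X]
      rw [← atomProd_eq_prod]
      exact h₁ z h
    · rw [map_zero, sub_zero]
      exact h₀ z h
  exact DFunLike.congr_fun this s

lemma smul_onex_eq_zero_of_theta {x : P} {s : FaceS K P} (w : Pmx P n y x)
    (hs : theta K P n y x s = AddMonoidAlgebra.single (0, Finsupp.single w 1) 1) :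
    s • onex K P n y x = 0 := by
  have hs' : theta K P n y x s = AddMonoidAlgebra.single
      (0, Finsupp.mapRange (Nat.cast : ℕ → ℤ) Nat.cast_zero (Finsupp.single w 1)) 1 := by
    rw [hs, Finsupp.mapRange_single, Nat.cast_one]
  apply ecoef_injective
  ext ⟨a, b⟩
  rw [ecoef_smul_right hs', onex, ecoef_emono, map_zero, Finsupp.zero_apply,
    Finsupp.single_apply, if_neg]
  intro h
  have := DFunLike.congr_fun (Prod.mk.inj h).2 w
  simp at this

lemma sub_atomHom_stalkHom_smul_onex (hy : AtomEnum P n y) (x : P) (s : FaceS K P) :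
    (s - atomHom K x (stalkHom K y x s)) • onex K P n y x = 0 := by
  have key : ∀ z : Pstar P, (X z - if z.1 ≤ x then atomProd (n := n) (y := y) K x z.1 else 0) •
      onex K P n y x = 0 := by
    intro z
    by_cases h : ∃ i : Fin n, y i ≤ x ∧ y i = z.1
    · obtain ⟨i, hi, hz⟩ := h
      have hT : atomsBelow y x z.1 = {⟨i, hi⟩} := Finset.ext fun k => by
        rw [mem_atomsBelow, ← hz, atom_le_atom_iff hy, Finset.mem_singleton, Subtype.ext_iff]
      rw [if_pos (hz ▸ hi), atomProd_eq_prod, hT, Finset.prod_singleton, hz, tvar_coe, sub_self,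
        zero_smul]
    · exact smul_onex_eq_zero_of_theta K ⟨z.1, z.2, h⟩ (theta_shiftVar K hy ⟨z.1, z.2, h⟩)
  refine sub_atomHom_stalkHom_mem K (J := Ideal.torsionOf (FaceS K P) _ (onex K P n y x))
    (fun z hz => ?_) (fun z hz => ?_) s
  · have := key z
    rwa [if_neg hz, sub_zero] at this
  · have := key z
    rwa [if_pos hz] at this

lemma ecoef_atomHom_smul_onex (hy : AtomEnum P n y) {x : P}
    (p : MvPolynomial (BelowIx P n y x) K) (c : BelowIx P n y x →₀ ℕ) :
    ecoef x (atomHom K x p • onex K P n y x)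
      (Finsupp.mapRange (Nat.cast : ℕ → ℤ) Nat.cast_zero c, 0) = p.coeff c := by
  induction p using MvPolynomial.induction_on' with
  | monomial d k =>
    rw [← mul_one k, ← smul_eq_mul, ← smul_monomial, map_smul (atomHom K x), smul_assoc,
      map_smul (ecoef x),
      ← emono_nat_eq_smul_onex K hy, ecoef_emono, Finsupp.smul_apply, coeff_smul, coeff_monomial,
      Finsupp.single_apply]
    congr 1
    refine if_congr ?_ rfl rfl
    rw [Prod.mk.injEq, and_iff_left rfl]
    exact (Finsupp.mapRange_injective _ Nat.cast_zero Nat.cast_injective).eq_iff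
  | add p q hp hq => rw [map_add, add_smul, map_add, Finsupp.add_apply, hp, hq, coeff_add]

lemma pIdeal_eq_torsionOf_onex (hP : IsSimplicialPoset P) (hy : AtomEnum P n y) (x : P) :
    pIdeal K P x = Ideal.torsionOf (FaceS K P) _ (onex K P n y x) := by
  ext s
  have h1 : s - atomHom K x (stalkHom K y x s) ∈ pIdeal K P x := by
    refine sub_atomHom_stalkHom_mem K (fun z hz => ?_) (fun z hz => ?_) s
    · rw [← tvar_coe]
      exact tvar_mem_pIdeal K hz
    · rw [atomProd_eq_prod, ← tvar_coe]
      exact tvar_sub_prod_mem_pIdeal K hP hy x _ z.1 hz rfl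
  have h2 := sub_atomHom_stalkHom_smul_onex K hy x s
  rw [sub_smul, sub_eq_zero] at h2
  rw [Ideal.mem_torsionOf_iff, h2]
  constructor
  · intro hs
    rw [stalkHom_eq_zero_of_mem_pIdeal K hP hy hs, map_zero, zero_smul]
  · intro hs
    have : stalkHom K y x s = 0 := by
      ext c
      rw [← ecoef_atomHom_smul_onex K hy, hs, map_zero, Finsupp.zero_apply, coeff_zero]
    rwa [this, map_zero, sub_zero] at h1

end FaceIdeal


section Dehomogenization

variable {P n y}

lemma exMod_hom_ext {V : Type} [AddCommGroup V] [Module K V] {x : P}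
    {f g : ExMod K P n y x →ₗ[K] V}
    (h : ∀ a b, f (emono K P n y x a b) = g (emono K P n y x a b)) : f = g := by
  refine LinearMap.ext fun e => ?_
  rw [eq_sum_emono e, map_sum, map_sum]
  exact Finset.sum_congr rfl fun q _ => by rw [map_smul, map_smul, h]

lemma tvar_atom_smul_emono (hy : AtomEnum P n y) {x : P} (i : BelowIx P n y x)
    (a : BelowIx P n y x →₀ ℤ) (b : Pmx P n y x →₀ ℕ) :
    tvar K P (y i) • emono K P n y x a b = emono K P n y x (a + Finsupp.single i 1) b := by
  apply ecoef_injective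
  ext ⟨a', b'⟩
  rw [ecoef_smul_left (theta_tvar_atom K hy i), ecoef_emono, ecoef_emono, Finsupp.single_apply,
    Finsupp.single_apply]
  refine if_congr ?_ rfl rfl
  rw [Prod.mk.injEq, Prod.mk.injEq, eq_sub_iff_add_eq]

lemma shiftHom_monomial_smul_emono (hy : AtomEnum P n y) {x : P} (d : Pmx P n y x →₀ ℕ)
    (a : BelowIx P n y x →₀ ℤ) (b : Pmx P n y x →₀ ℕ) :
    shiftHom K x (monomial d 1) • emono K P n y x a b =
      if d ≤ b then emono K P n y x a (b - d) else 0 := by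
  apply ecoef_injective
  ext ⟨a', b'⟩
  rw [ecoef_smul_right (theta_shiftHom_monomial K hy d), ecoef_emono, Finsupp.single_apply]
  split_ifs with h1 h2 h2
  · rw [ecoef_emono, (Prod.mk.inj h1).1, (Prod.mk.inj h1).2, add_tsub_cancel_right,
      Finsupp.single_eq_same]
  · exact absurd ((Prod.mk.inj h1).2 ▸ le_add_self) h2
  · rw [ecoef_emono, Finsupp.single_apply, if_neg]
    rintro h
    obtain ⟨rfl, rfl⟩ := Prod.mk.inj h
    exact h1 (by rw [tsub_add_cancel_of_le h2])
  · rw [map_zero, Finsupp.zero_apply]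

/-- The map setting all the variables of the Laurent polynomial factor of `*E_x` to `1`. -/
def dehom (x : P) : ExMod K P n y x →ₗ[K] ((Pmx P n y x →₀ ℕ) →₀ K) :=
  Finsupp.lmapDomain K K Prod.snd ∘ₗ ecoef x

lemma dehom_emono {x : P} (a : BelowIx P n y x →₀ ℤ) (b : Pmx P n y x →₀ ℕ) :
    dehom K x (emono K P n y x a b) = Finsupp.single b 1 := by
  rw [dehom, LinearMap.comp_apply, ecoef_emono, Finsupp.lmapDomain_apply,
    Finsupp.mapDomain_single]

lemma dehom_tvar_atom_smul (hy : AtomEnum P n y) {x : P} (i : BelowIx P n y x)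
    (e : ExMod K P n y x) : dehom K x (tvar K P (y i) • e) = dehom K x e := by
  have : dehom K x ∘ₗ (DistribSMul.toLinearMap K (ExMod K P n y x) (tvar K P (y i))) =
      dehom K x := by
    refine exMod_hom_ext K fun a b => ?_
    rw [LinearMap.comp_apply, DistribSMul.toLinearMap_apply, tvar_atom_smul_emono K hy,
      dehom_emono, dehom_emono]
  exact DFunLike.congr_fun this e

lemma dehom_shiftHom_smul (hy : AtomEnum P n y) {x : P} (p : MvPolynomial (Pmx P n y x) K)
    (e : ExMod K P n y x) : dehom K x (shiftHom K x p • e) = p • dehom K x e := by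
  induction p using MvPolynomial.induction_on' with
  | monomial d k =>
    have : dehom K x ∘ₗ (DistribSMul.toLinearMap K (ExMod K P n y x)
        (shiftHom K x (monomial d 1))) =
        (DistribSMul.toLinearMap K ((Pmx P n y x →₀ ℕ) →₀ K) (monomial d (1 : K))) ∘ₗ
          dehom K x := by
      refine exMod_hom_ext K fun a b => ?_
      rw [LinearMap.comp_apply, LinearMap.comp_apply, DistribSMul.toLinearMap_apply,
        DistribSMul.toLinearMap_apply, shiftHom_monomial_smul_emono K hy, dehom_emono]
      ext b'
      rw [inverseSystem_monomial_smul_apply, one_mul, Finsupp.single_apply]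
      split_ifs with h1 h2 h2
      · rw [dehom_emono, h2, add_tsub_cancel_right, Finsupp.single_eq_same]
      · rw [dehom_emono, Finsupp.single_apply, if_neg]
        rintro rfl
        exact h2 (tsub_add_cancel_of_le h1).symm
      · exact absurd (h2 ▸ le_add_self) h1
      · rw [map_zero, Finsupp.zero_apply]
    have := DFunLike.congr_fun this e
    rw [LinearMap.comp_apply, LinearMap.comp_apply, DistribSMul.toLinearMap_apply,
      DistribSMul.toLinearMap_apply] at this
    rw [← mul_one k, ← smul_eq_mul, ← smul_monomial, map_smul (shiftHom K x), smul_assoc,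
      map_smul (dehom K x), this, smul_assoc]
  | add p q hp hq => rw [map_add, add_smul, map_add, hp, hq, add_smul]

lemma gdeg_mIdx {x : P} (a : BelowIx P n y x →₀ ℤ) (b : Pmx P n y x →₀ ℕ) (i : Fin n) :
    gdeg P n y x (mIdx P n y x a b) i = (if h : y i ≤ x then a ⟨i, h⟩ else 0) -
      ∑ w, (b w : ℤ) * (if y i ≤ w.1 then 1 else 0) := by
  rw [gdeg, mIdx, Finsupp.sum_fintype _ _ (by simp), sub_eq_add_neg, ← Finset.sum_neg_distrib]
  congr 1
  exact Finset.sum_congr rfl fun w _ => by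
    rw [Finsupp.neg_apply, Finsupp.mapRange_apply, neg_mul]

lemma gdeg_mIdx_sub_single (hy : AtomEnum P n y) {x : P} (a : BelowIx P n y x →₀ ℤ)
    (b : Pmx P n y x →₀ ℕ) (i : BelowIx P n y x) :
    gdeg P n y x (mIdx P n y x (a - Finsupp.single i 1) b) =
      gdeg P n y x (mIdx P n y x a b) - tdeg P n y ⟨y i, atom_ne_bot hy i⟩ := by
  ext j
  rw [Pi.sub_apply, gdeg_mIdx, gdeg_mIdx, tdeg]
  simp only [atom_le_atom_iff hy]
  by_cases h : j = i
  · subst h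
    rw [dif_pos i.2, dif_pos i.2, if_pos rfl, Finsupp.sub_apply, Finsupp.single_eq_same]
    ring
  · rw [if_neg h, sub_zero]
    congr 1
    split_ifs with h'
    · rw [Finsupp.sub_apply, Finsupp.single_eq_of_ne, sub_zero]
      exact fun hj => h (congrArg Subtype.val hj)
    · rfl

lemma gdeg_mIdx_add_single {x : P} (a : BelowIx P n y x →₀ ℤ)
    (b : Pmx P n y x →₀ ℕ) (w : Pmx P n y x) :
    gdeg P n y x (mIdx P n y x a (b + Finsupp.single w 1)) =
      gdeg P n y x (mIdx P n y x a b) - tdeg P n y ⟨w.1, w.2.1⟩ := by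
  ext j
  rw [Pi.sub_apply, gdeg_mIdx, gdeg_mIdx, tdeg, sub_sub]
  congr 1
  simp only [Finsupp.add_apply, Nat.cast_add, add_mul, Finset.sum_add_distrib]
  congr 1
  rw [Finset.sum_eq_single w (fun v _ hv => by rw [Finsupp.single_eq_of_ne hv]; simp) (by simp)]
  simp

/-- The exponent of the first factor of a monomial of `*E_x` of degree `aa` with second factor
of exponent `b`. -/
def liftExp (x : P) (aa : Fin n → ℤ) (b : Pmx P n y x →₀ ℕ) : BelowIx P n y x →₀ ℤ :=
  Finsupp.equivFunOnFinite.symm fun i => aa i + ∑ w, (b w : ℤ) * (if y i ≤ w.1 then 1 else 0)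

lemma eq_liftExp {x : P} {aa : Fin n → ℤ} {a : BelowIx P n y x →₀ ℤ} {b : Pmx P n y x →₀ ℕ}
    (h : gdeg P n y x (mIdx P n y x a b) = aa) : a = liftExp x aa b := by
  ext i
  rw [liftExp, Finsupp.equivFunOnFinite_symm_apply_apply, ← h, gdeg_mIdx, dif_pos i.2]
  ring

/-- Homogenization in degree `aa`, a partial inverse of `dehom`. -/
def homog (x : P) (aa : Fin n → ℤ) : ((Pmx P n y x →₀ ℕ) →₀ K) →ₗ[K] ExMod K P n y x :=
  Finsupp.linearCombination K fun b =>
    if gdeg P n y x (mIdx P n y x (liftExp x aa b) b) = aa then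
      emono K P n y x (liftExp x aa b) b else 0

lemma ecoef_homog {x : P} (aa : Fin n → ℤ) (d : (Pmx P n y x →₀ ℕ) →₀ K)
    (a : BelowIx P n y x →₀ ℤ) (b : Pmx P n y x →₀ ℕ) :
    ecoef x (homog K x aa d) (a, b) =
      if gdeg P n y x (mIdx P n y x a b) = aa then d b else 0 := by
  induction d using Finsupp.induction_linear with
  | zero => simp
  | add d e hd he =>
    rw [map_add, map_add, Finsupp.add_apply, hd, he, Finsupp.add_apply]
    split_ifs
    · rfl
    · rw [add_zero]
  | single b' k =>
    rw [homog, Finsupp.linearCombination_single, map_smul, Finsupp.smul_apply, smul_eq_mul]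
    by_cases hb : b' = b
    · subst hb
      rw [Finsupp.single_eq_same]
      by_cases h : gdeg P n y x (mIdx P n y x a b') = aa
      · rw [if_pos h, ← eq_liftExp h, if_pos h, ecoef_emono, Finsupp.single_eq_same, mul_one]
      · rw [if_neg h]
        split_ifs with h'
        · rw [ecoef_emono, Finsupp.single_apply, if_neg, mul_zero]
          rintro hab
          exact h ((Prod.mk.inj hab).1 ▸ h')
        · rw [map_zero, Finsupp.zero_apply, mul_zero]
    · rw [Finsupp.single_apply, if_neg hb, ite_self]
      split_ifs with h'
      · rw [ecoef_emono, Finsupp.single_apply, if_neg, mul_zero]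
        exact fun hab => hb (Prod.mk.inj hab).2
      · rw [map_zero, Finsupp.zero_apply, mul_zero]

lemma homog_mem (x : P) (aa : Fin n → ℤ) (d : (Pmx P n y x →₀ ℕ) →₀ K) :
    homog K x aa d ∈ ExGrade K P n y x aa := by
  rw [homog, Finsupp.linearCombination_apply]
  refine Submodule.sum_mem _ fun b _ => Submodule.smul_mem _ _ ?_
  split_ifs with h
  · exact Submodule.subset_span ⟨_, h, rfl⟩
  · exact zero_mem _

lemma homog_dehom {x : P} {aa : Fin n → ℤ} {e : ExMod K P n y x}
    (he : e ∈ ExGrade K P n y x aa) : homog K x aa (dehom K x e) = e := by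
  induction he using Submodule.span_induction with
  | mem e he =>
    obtain ⟨p, hp, rfl⟩ := he
    rcases exists_pos_or_eq_mIdx p with h | ⟨a, b, rfl⟩
    · rw [mk_single_eq_zero h, map_zero, map_zero]
    · change homog K x aa (dehom K x (emono K P n y x a b)) = emono K P n y x a b
      rw [dehom_emono, homog, Finsupp.linearCombination_single, one_smul, ← eq_liftExp hp,
        if_pos hp]
  | zero => rw [map_zero, map_zero]
  | add e e' _ _ he he' => rw [map_add, map_add, he, he']
  | smul k e _ he => rw [map_smul, map_smul, he]

lemma homog_add_tdeg_atom (hy : AtomEnum P n y) {x : P} (aa : Fin n → ℤ) (i : BelowIx P n y x)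
    (d : (Pmx P n y x →₀ ℕ) →₀ K) :
    homog K x (aa + tdeg P n y ⟨y i, atom_ne_bot hy i⟩) d =
      tvar K P (y i) • homog K x aa d := by
  apply ecoef_injective
  ext ⟨a, b⟩
  rw [ecoef_smul_left (theta_tvar_atom K hy i), ecoef_homog, ecoef_homog,
    gdeg_mIdx_sub_single hy]
  exact if_congr sub_eq_iff_eq_add.symm rfl rfl

lemma homog_add_tdeg_shift (hy : AtomEnum P n y) {x : P} (aa : Fin n → ℤ) (w : Pmx P n y x)
    (d : (Pmx P n y x →₀ ℕ) →₀ K) :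
    homog K x (aa + tdeg P n y ⟨w.1, w.2.1⟩) ((X w : MvPolynomial (Pmx P n y x) K) • d) =
      shiftVar K x w • homog K x aa d := by
  have hw : theta K P n y x (shiftVar K x w) = AddMonoidAlgebra.single
      (0, Finsupp.mapRange (Nat.cast : ℕ → ℤ) Nat.cast_zero (Finsupp.single w 1)) 1 := by
    rw [theta_shiftVar K hy, Finsupp.mapRange_single, Nat.cast_one]
  apply ecoef_injective
  ext ⟨a, b⟩
  rw [ecoef_smul_right hw, ecoef_homog, ecoef_homog, gdeg_mIdx_add_single, X,
    inverseSystem_monomial_smul_apply, one_mul]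
  exact if_congr sub_eq_iff_eq_add.symm rfl rfl

end Dehomogenization

section GradedModules

variable {P n y}
variable {M : Type} [AddCommGroup M] [Module (FaceS K P) M]

/-- The additive map which is given by `φ aa` in each degree `aa`. -/
def glue {V : Type} [AddCommGroup V] (gM : GradedSMod K P n y M) (φ : (Fin n → ℤ) → M →+ V) :
    M →+ V :=
  (DirectSum.toAddMonoid fun aa => (φ aa).comp (gM.grade aa).subtype).comp
    (AddEquiv.ofBijective (DirectSum.coeAddMonoidHom gM.grade) gM.internal).symm.toAddMonoidHom

variable {K}

lemma glue_of_mem {V : Type} [AddCommGroup V] {gM : GradedSMod K P n y M}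
    {φ : (Fin n → ℤ) → M →+ V} {aa : Fin n → ℤ} {m : M} (hm : m ∈ gM.grade aa) :
    glue K gM φ m = φ aa m := by
  have h : (AddEquiv.ofBijective (DirectSum.coeAddMonoidHom gM.grade) gM.internal).symm m =
      DirectSum.of (fun aa => gM.grade aa) aa ⟨m, hm⟩ := by
    rw [AddEquiv.symm_apply_eq]
    exact (DirectSum.coeAddMonoidHom_of gM.grade aa ⟨m, hm⟩).symm
  change DirectSum.toAddMonoid _
    ((AddEquiv.ofBijective (DirectSum.coeAddMonoidHom gM.grade) gM.internal).symm m) = _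
  rw [h, DirectSum.toAddMonoid_of]
  rfl

lemma mem_closure_homogeneous_of_top (gM : GradedSMod K P n y M) (m : M) :
    m ∈ AddSubgroup.closure {m | ∃ aa, m ∈ gM.grade aa} := by
  obtain ⟨v, rfl⟩ := gM.internal.surjective m
  induction v using DirectSum.induction_on with
  | zero => rw [map_zero]; exact zero_mem _
  | of aa m =>
    rw [DirectSum.coeAddMonoidHom_of]
    exact AddSubgroup.subset_closure ⟨aa, m.2⟩
  | add v w hv hw => rw [map_add]; exact add_mem hv hw

lemma addHom_ext_homogeneous {V : Type} [AddCommGroup V] (gM : GradedSMod K P n y M)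
    {f g : M →+ V} (h : ∀ aa, ∀ m ∈ gM.grade aa, f m = g m) : f = g := by
  ext m
  induction mem_closure_homogeneous_of_top gM m using AddSubgroup.closure_induction with
  | mem m hm => exact h _ m hm.choose_spec
  | zero => rw [map_zero, map_zero]
  | add a b _ _ ha hb => rw [map_add, map_add, ha, hb]
  | neg a _ ha => rw [map_neg, map_neg, ha]

lemma C_mem_Sgrade (k : K) : (C k : FaceS K P) ∈ Sgrade K P n y 0 :=
  isWeightedHomogeneous_C _ k

lemma X_mem_Sgrade (z : Pstar P) : (X z : FaceS K P) ∈ Sgrade K P n y (tdeg P n y z) :=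
  isWeightedHomogeneous_X _ _ z

lemma tvar_atom_mem_Sgrade (hy : AtomEnum P n y) (i : Fin n) :
    tvar K P (y i) ∈ Sgrade K P n y (tdeg P n y ⟨y i, atom_ne_bot hy i⟩) := by
  rw [tvar, dif_neg (atom_ne_bot hy i)]
  exact X_mem_Sgrade _

lemma atomProd_mem_Sgrade (hy : AtomEnum P n y) {x : P} (z : Pstar P) (hz : z.1 ≤ x) :
    atomProd (n := n) (y := y) K x z.1 ∈ Sgrade K P n y (tdeg P n y z) := by
  have h : ∀ i ∈ (Finset.univ : Finset (BelowIx P n y x)),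
      IsWeightedHomogeneous (tdeg P n y) (if y i ≤ z.1 then tvar K P (y i) else 1)
        (if y i ≤ z.1 then tdeg P n y ⟨y i, atom_ne_bot hy i⟩ else 0) := by
    intro i _
    split_ifs
    · exact tvar_atom_mem_Sgrade hy i
    · exact isWeightedHomogeneous_one _ _
  have hd : ∑ i : BelowIx P n y x,
      (if y i ≤ z.1 then tdeg P n y ⟨y i, atom_ne_bot hy i⟩ else 0) = tdeg P n y z := by
    ext j
    rw [Finset.sum_apply]
    by_cases hj : y j ≤ z.1
    · rw [Finset.sum_eq_single ⟨j, hj.trans hz⟩]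
      · simp [tdeg, hj]
      · intro i _ hij
        split_ifs
        · rw [tdeg, if_neg]
          exact fun h => hij (Subtype.ext ((atom_le_atom_iff hy _ _).1 h).symm)
        · rfl
      · simp
    · rw [tdeg, if_neg hj]
      refine Finset.sum_eq_zero fun i _ => ?_
      split_ifs with hi
      · rw [tdeg, if_neg]
        exact fun h => hj (h.trans hi)
      · rfl
  have := IsWeightedHomogeneous.prod _ _ _ h
  rw [hd] at this
  exact this

lemma shiftVar_mem_Sgrade (hy : AtomEnum P n y) {x : P} (w : Pmx P n y x) :
    shiftVar K x w ∈ Sgrade K P n y (tdeg P n y ⟨w.1, w.2.1⟩) := by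
  refine sub_mem (X_mem_Sgrade _) ?_
  split_ifs with h
  · exact atomProd_mem_Sgrade hy ⟨w.1, w.2.1⟩ h
  · exact zero_mem _

lemma mem_closure_homogeneous {gM : GradedSMod K P n y M} {N : Submodule (FaceS K P) M}
    (hN : N = Submodule.span (FaceS K P) {m | m ∈ N ∧ ∃ aa, m ∈ gM.grade aa}) {m : M}
    (hm : m ∈ N) : m ∈ AddSubgroup.closure {m | m ∈ N ∧ ∃ aa, m ∈ gM.grade aa} := by
  have hsmul : ∀ (d : Fin n → ℤ), ∀ s ∈ Sgrade K P n y d,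
      ∀ m ∈ AddSubgroup.closure {m | m ∈ N ∧ ∃ aa, m ∈ gM.grade aa},
      s • m ∈ AddSubgroup.closure {m | m ∈ N ∧ ∃ aa, m ∈ gM.grade aa} := by
    intro d s hs m hm
    induction hm using AddSubgroup.closure_induction with
    | mem m hm =>
      obtain ⟨hmN, aa, haa⟩ := hm
      exact AddSubgroup.subset_closure ⟨N.smul_mem _ hmN, _, gM.smul_le d aa s hs m haa⟩
    | zero => rw [smul_zero]; exact zero_mem _
    | add a b _ _ ha hb => rw [smul_add]; exact add_mem ha hb
    | neg a _ ha => rw [smul_neg]; exact neg_mem ha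
  rw [hN] at hm
  induction hm using Submodule.span_induction with
  | mem m hm => exact AddSubgroup.subset_closure hm
  | zero => exact zero_mem _
  | add a b _ _ ha hb => exact add_mem ha hb
  | smul s m _ hm =>
    induction s using MvPolynomial.induction_on generalizing m with
    | C k => exact hsmul _ _ (C_mem_Sgrade k) _ hm
    | add p q hp hq =>
      rw [add_smul]
      exact add_mem (hp m ‹_› hm) (hq m ‹_› hm)
    | mul_X p z hp =>
      rw [mul_smul]
      exact hp _ (Submodule.smul_mem _ _ ‹_›) (hsmul _ _ (X_mem_Sgrade z) _ hm)

variable (K)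

/-- The monomial in the atoms below `x` raising the degree from `aa` to `T` on these atoms. -/
def atomPow (x : P) (T : BelowIx P n y x → ℤ) (aa : Fin n → ℤ) : FaceS K P :=
  ∏ i : BelowIx P n y x, tvar K P (y i) ^ (T i - aa i).toNat

variable {K}

lemma atomPow_add_tdeg (hy : AtomEnum P n y) {x : P} {T : BelowIx P n y x → ℤ} {aa : Fin n → ℤ}
    {i : BelowIx P n y x} (hT : aa i + 1 ≤ T i) :
    atomPow K x T (aa + tdeg P n y ⟨y i, atom_ne_bot hy i⟩) * tvar K P (y i) =
      atomPow K x T aa := by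
  rw [atomPow, atomPow, ← Finset.mul_prod_erase _ _ (Finset.mem_univ i),
    ← Finset.mul_prod_erase _ _ (Finset.mem_univ i), mul_right_comm, ← pow_succ]
  congr 1
  · congr 1
    simp only [Pi.add_apply, tdeg, le_refl, if_true]
    omega
  · refine Finset.prod_congr rfl fun j hj => ?_
    have : ¬ y j ≤ y i := fun h =>
      (Finset.mem_erase.1 hj).1 (Subtype.ext ((atom_le_atom_iff hy _ _).1 h))
    simp only [Pi.add_apply, tdeg, if_neg this, add_zero]

variable (K)

/-- The map multiplying each homogeneous component so as to reach the degree `T`. -/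
def raise (gM : GradedSMod K P n y M) (x : P) (T : BelowIx P n y x → ℤ) : M →+ M :=
  glue K gM fun aa => DistribSMul.toAddMonoidHom M (atomPow K x T aa)

/-- The submodule by which one quotients `M` to set the atoms below `x` equal to `1`. -/
def atomSubOne (y : Fin n → P) (M : Type) [AddCommGroup M] [Module (FaceS K P) M] (x : P) :
    Submodule (FaceS K P) M :=
  ⨆ i : BelowIx P n y x, LinearMap.range (LinearMap.lsmul (FaceS K P) M (tvar K P (y i) - 1))

variable {K}

lemma raise_of_mem {gM : GradedSMod K P n y M} {x : P} {T : BelowIx P n y x → ℤ}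
    {aa : Fin n → ℤ} {m : M} (hm : m ∈ gM.grade aa) :
    raise K gM x T m = atomPow K x T aa • m := glue_of_mem hm

lemma eventually_raise_eq_zero (hy : AtomEnum P n y) (gM : GradedSMod K P n y M) {x : P} {m : M}
    (hm : m ∈ atomSubOne K y M x) : ∀ᶠ T in Filter.atTop, raise K gM x T m = 0 := by
  induction hm using Submodule.iSup_induction' with
  | mem i m hm =>
    obtain ⟨m, rfl⟩ := hm
    simp only [LinearMap.lsmul_apply]
    induction mem_closure_homogeneous_of_top gM m using AddSubgroup.closure_induction with
    | mem m hm =>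
      obtain ⟨aa, hm⟩ := hm
      filter_upwards [Filter.eventually_ge_atTop fun j : BelowIx P n y x => aa j + 1] with T hT
      rw [sub_smul, one_smul, map_sub, raise_of_mem hm,
        raise_of_mem (gM.smul_le _ _ _ (tvar_atom_mem_Sgrade hy i) _ hm), smul_smul,
        atomPow_add_tdeg hy (hT i), sub_self]
    | zero => exact Filter.Eventually.of_forall fun T => by rw [smul_zero, map_zero]
    | add a b _ _ ha hb =>
      filter_upwards [ha, hb] with T ha hb
      rw [smul_add, map_add, ha, hb, add_zero]
    | neg a _ ha =>
      filter_upwards [ha] with T ha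
      rw [smul_neg, map_neg, ha, neg_zero]
  | zero => exact Filter.Eventually.of_forall fun T => map_zero _
  | add a b _ _ ha hb =>
    filter_upwards [ha, hb] with T ha hb
    rw [map_add, ha, hb, add_zero]

lemma raise_mem_and_eq {V : Type} [AddCommGroup V] {gM : GradedSMod K P n y M} {x : P}
    {N : Submodule (FaceS K P) M}
    (hN : N = Submodule.span (FaceS K P) {m | m ∈ N ∧ ∃ aa, m ∈ gM.grade aa}) {f : N →+ V}
    (hf : ∀ (i : BelowIx P n y x) (m : N), f (tvar K P (y i) • m) = f m)
    (T : BelowIx P n y x → ℤ) {m : M} (hm : m ∈ N) :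
    ∃ h : raise K gM x T m ∈ N, f ⟨raise K gM x T m, h⟩ = f ⟨m, hm⟩ := by
  have hpow : ∀ (aa : Fin n → ℤ) (m : N), f (atomPow K x T aa • m) = f m := by
    intro aa m
    let H : Submonoid (FaceS K P) :=
      { carrier := {s | ∀ m, f (s • m) = f m}
        one_mem' := fun m => by rw [one_smul]
        mul_mem' := fun {s t} hs ht m => by rw [mul_smul, hs, ht] }
    exact (prod_mem (S := H) fun (i : BelowIx P n y x) _ =>
      pow_mem (show tvar K P (y i) ∈ H from hf i) _) m
  suffices H : ∀ m ∈ AddSubgroup.closure {m | m ∈ N ∧ ∃ aa, m ∈ gM.grade aa}, ∃ (h : m ∈ N)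
      (h' : raise K gM x T m ∈ N), f ⟨raise K gM x T m, h'⟩ = f ⟨m, h⟩ from
    (H m (mem_closure_homogeneous hN hm)).2
  intro m hm
  induction hm using AddSubgroup.closure_induction with
  | mem m hm =>
    obtain ⟨hmN, aa, hm⟩ := hm
    simp only [raise_of_mem hm]
    exact ⟨hmN, N.smul_mem _ hmN, hpow aa ⟨m, hmN⟩⟩
  | zero =>
    simp only [map_zero]
    exact ⟨zero_mem _, zero_mem _, trivial⟩
  | add a b _ _ ha hb =>
    obtain ⟨ha, ha', hfa⟩ := ha
    obtain ⟨hb, hb', hfb⟩ := hb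
    simp only [map_add]
    refine ⟨add_mem ha hb, add_mem ha' hb', ?_⟩
    have := congrArg₂ (· + ·) hfa hfb
    simp only [← map_add] at this
    exact this
  | neg a _ ha =>
    obtain ⟨ha, ha', hfa⟩ := ha
    simp only [map_neg]
    refine ⟨neg_mem ha, neg_mem ha', ?_⟩
    have := congrArg (- ·) hfa
    simp only [← map_neg] at this
    exact this

lemma eq_zero_of_mem_atomSubOne (hy : AtomEnum P n y) {V : Type} [AddCommGroup V]
    {gM : GradedSMod K P n y M} {x : P} {N : Submodule (FaceS K P) M}
    (hN : N = Submodule.span (FaceS K P) {m | m ∈ N ∧ ∃ aa, m ∈ gM.grade aa}) {f : N →+ V}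
    (hf : ∀ (i : BelowIx P n y x) (m : N), f (tvar K P (y i) • m) = f m)
    (m : N) (hm : (m : M) ∈ atomSubOne K y M x) : f m = 0 := by
  obtain ⟨T, hT⟩ := (eventually_raise_eq_zero hy gM hm).exists
  obtain ⟨h, hfm⟩ := raise_mem_and_eq hN hf T m.2
  rw [← hfm, ← map_zero f]
  congr 1
  exact Subtype.ext hT

end GradedModules

section Injectivity

variable {P n y}
variable {M : Type} [AddCommGroup M] [Module (FaceS K P) M]
variable {K}

lemma subalgebra_eq_top {x : P} {H : Subalgebra K (FaceS K P)}
    (h₁ : ∀ i : BelowIx P n y x, tvar K P (y i) ∈ H)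
    (h₂ : ∀ w : Pmx P n y x, shiftVar K x w ∈ H) : H = ⊤ := by
  rw [eq_top_iff, ← adjoin_range_X, Algebra.adjoin_le_iff]
  rintro _ ⟨z, rfl⟩
  by_cases h : ∃ i : Fin n, y i ≤ x ∧ y i = z.1
  · obtain ⟨i, hi, hz⟩ := h
    rw [← tvar_coe, ← hz]
    exact h₁ ⟨i, hi⟩
  · have := h₂ ⟨z.1, z.2, h⟩
    rw [shiftVar] at this
    refine (add_mem_cancel_right (neg_mem ?_)).1 (sub_eq_add_neg (X z : FaceS K P) _ ▸ this)
    split_ifs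
    · refine prod_mem fun i _ => ?_
      split_ifs
      · exact h₁ i
      · exact one_mem _
    · exact zero_mem _

lemma glue_homog_smul (hy : AtomEnum P n y) (gM : GradedSMod K P n y M) {x : P}
    {g : M →+ ((Pmx P n y x →₀ ℕ) →₀ K)}
    (hg : ∀ (p : MvPolynomial (Pmx P n y x) K) m, g (shiftHom K x p • m) = p • g m)
    (hg' : ∀ (i : BelowIx P n y x) m, g (tvar K P (y i) • m) = g m) (s : FaceS K P) (m : M) :
    glue K gM (fun aa => (homog K x aa).toAddMonoidHom.comp g) (s • m) =
      s • glue K gM (fun aa => (homog K x aa).toAddMonoidHom.comp g) m := by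
  set G := glue K gM (fun aa => (homog K x aa).toAddMonoidHom.comp g)
  have hGm : ∀ aa, ∀ m ∈ gM.grade aa, G m = homog K x aa (g m) := fun aa m hm =>
    glue_of_mem hm
  have key : ∀ d, ∀ s ∈ Sgrade K P n y d,
      (∀ aa m, homog K x (aa + d) (g (s • m)) = s • homog K x aa (g m)) →
      ∀ m, G (s • m) = s • G m := by
    intro d s hs h m
    have : G.comp (DistribSMul.toAddMonoidHom M s) =
        (DistribSMul.toAddMonoidHom (ExMod K P n y x) s).comp G := by
      refine addHom_ext_homogeneous gM fun aa m hm => ?_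
      change G (s • m) = s • G m
      rw [hGm _ _ (gM.smul_le _ _ _ hs _ hm), hGm _ _ hm, h]
    exact DFunLike.congr_fun this m
  let H : Subalgebra K (FaceS K P) :=
    { carrier := {s | ∀ m, G (s • m) = s • G m}
      mul_mem' := fun {s t} hs ht m => by rw [mul_smul, hs, ht, mul_smul]
      add_mem' := fun {s t} hs ht m => by rw [add_smul, map_add, hs, ht, add_smul]
      algebraMap_mem' := fun k => by
        refine key 0 _ (C_mem_Sgrade k) fun aa m => ?_
        have := hg (algebraMap K _ k) m
        rw [AlgHom.commutes] at this
        rw [add_zero, this, algebraMap_smul, algebraMap_smul, map_smul] }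
  have hH : H = ⊤ := by
    refine subalgebra_eq_top (y := y) (x := x) (fun i => ?_) fun w => ?_
    · refine key _ _ (tvar_atom_mem_Sgrade hy i) fun aa m => ?_
      rw [hg', homog_add_tdeg_atom K hy]
    · refine key _ _ (shiftVar_mem_Sgrade hy w) fun aa m => ?_
      rw [← homog_add_tdeg_shift K hy, ← hg, shiftHom, aeval_X]
  exact (hH ▸ Algebra.mem_top : s ∈ H) m

lemma exists_graded_extension (hy : AtomEnum P n y) (x : P) (gM : GradedSMod K P n y M)
    (N : Submodule (FaceS K P) M)
    (hN : N = Submodule.span (FaceS K P) {m | m ∈ N ∧ ∃ aa, m ∈ gM.grade aa})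
    (f : N →ₗ[FaceS K P] ExMod K P n y x)
    (hf : ∀ aa (m : N), (m : M) ∈ gM.grade aa → f m ∈ ExGrade K P n y x aa) :
    ∃ g : M →ₗ[FaceS K P] ExMod K P n y x,
      (∀ aa, ∀ m ∈ gM.grade aa, g m ∈ ExGrade K P n y x aa) ∧ ∀ m : N, g m = f m := by
  have hinj : Module.Injective (MvPolynomial (Pmx P n y x) K) ((Pmx P n y x →₀ ℕ) →₀ K) :=
    inverseSystem_injective
  let f' : N →+ ((Pmx P n y x →₀ ℕ) →₀ K) := (dehom K x).toAddMonoidHom.comp f.toAddMonoidHom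
  have hf' : ∀ m, f' m = dehom K x (f m) := fun _ => rfl
  obtain ⟨g', hg', hJ, hgf⟩ := exists_extension_vanishing (shiftHom K x).toRingHom N
    (atomSubOne K y M x) f'
    (fun p m => by
      change f' (shiftHom K x p • m) = _
      rw [hf', hf', map_smul, dehom_shiftHom_smul K hy])
    (eq_zero_of_mem_atomSubOne hy hN fun i m => by
      rw [hf', hf', map_smul, dehom_tvar_atom_smul K hy])
  have hatom : ∀ (i : BelowIx P n y x) m, g' (tvar K P (y i) • m) = g' m := by
    intro i m
    rw [← sub_eq_zero, ← map_sub]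
    refine hJ _ (Submodule.mem_iSup_of_mem i ⟨m, ?_⟩)
    rw [LinearMap.lsmul_apply, sub_smul, one_smul]
  refine ⟨{ glue K gM fun aa => (homog K x aa).toAddMonoidHom.comp g' with
    map_smul' := glue_homog_smul hy gM hg' hatom }, fun aa m hm => ?_, fun m => ?_⟩
  · change glue K gM _ m ∈ _
    rw [glue_of_mem hm]
    exact homog_mem K x aa _
  · change glue K gM (fun aa => (homog K x aa).toAddMonoidHom.comp g') m = f m
    suffices H : ∀ m ∈ AddSubgroup.closure {m | m ∈ N ∧ ∃ aa, m ∈ gM.grade aa},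
        ∃ h : m ∈ N, glue K gM (fun aa => (homog K x aa).toAddMonoidHom.comp g') m = f ⟨m, h⟩ from
      (H m (mem_closure_homogeneous hN m.2)).2
    intro m hm
    induction hm using AddSubgroup.closure_induction with
    | mem m hm =>
      obtain ⟨hmN, aa, hm⟩ := hm
      refine ⟨hmN, ?_⟩
      rw [glue_of_mem hm]
      change homog K x aa (g' m) = _
      rw [hgf ⟨m, hmN⟩, hf', homog_dehom K (hf aa ⟨m, hmN⟩ hm)]
    | zero => exact ⟨zero_mem _, (map_zero _).trans (map_zero f).symm⟩
    | add a b _ _ ha hb =>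
      obtain ⟨ha, hfa⟩ := ha
      obtain ⟨hb, hfb⟩ := hb
      refine ⟨add_mem ha hb, ?_⟩
      rw [map_add, hfa, hfb, ← map_add]
      rfl
    | neg a _ ha =>
      obtain ⟨ha, hfa⟩ := ha
      refine ⟨neg_mem ha, ?_⟩
      rw [map_neg, hfa, ← map_neg]
      rfl

end Injectivity

/-- Theorem 2.5: `*E_x` is the injective envelope of
`S_x = S/p_x` in the category of `ℤⁿ`-graded `S`-modules: it contains a copy of
`S/p_x` (the submodule `S•1_x`), it is a *essential extension of it, and it is
an injective object of the category (every degree preserving map into `*E_x`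
from a graded submodule of a graded module extends to a degree preserving map). -/
theorem statement4
    (hP : IsSimplicialPoset P) (hy : AtomEnum P n y)
    (x : P) (r : ℕ) (hr : 1 ≤ r)
    (hx : ∀ i : Fin n, y i ≤ x ↔ (i : ℕ) < r) :
    Nonempty ((FaceS K P ⧸ pIdeal K P x) ≃ₗ[FaceS K P]
        Submodule.span (FaceS K P) {onex K P n y x}) ∧
    (∀ α : ExMod K P n y x, α ≠ 0 → (∃ aa, α ∈ ExGrade K P n y x aa) →
      ∃ s : FaceS K P, s • α ≠ 0 ∧
        s • α ∈ Submodule.span (FaceS K P) {onex K P n y x}) ∧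
    (∀ (M : Type) [AddCommGroup M] [Module (FaceS K P) M],
      ∀ (gM : GradedSMod K P n y M) (N : Submodule (FaceS K P) M),
        N = Submodule.span (FaceS K P) {m | m ∈ N ∧ ∃ aa, m ∈ gM.grade aa} →
        ∀ f : N →ₗ[FaceS K P] ExMod K P n y x,
          (∀ aa (m : N), (m : M) ∈ gM.grade aa → f m ∈ ExGrade K P n y x aa) →
          ∃ g : M →ₗ[FaceS K P] ExMod K P n y x,
            (∀ aa, ∀ m ∈ gM.grade aa, g m ∈ ExGrade K P n y x aa) ∧
            ∀ m : N, g m = f m) := by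
  refine ⟨⟨(Submodule.quotEquivOfEq _ _ (pIdeal_eq_torsionOf_onex K hP hy x)).trans
    (Ideal.quotTorsionOfEquivSpanSingleton (FaceS K P) _ (onex K P n y x))⟩,
    fun α hα _ => exists_smul_mem_span_onex K hy hα, ?_⟩
  intro M _ _ gM N hN f hf
  exact exists_graded_extension hy x gM N hN f hf

end
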